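/- Let n ≥ 2 and let Ω ⊂ ℝⁿ be a bounded set of finite perimeter. Then H^{n−1}(∂Ω ∩ Ω¹) < ∞ if and only if there exists a sequence of bounded open sets E_k with smooth boundary such that E_k ⋐ Ω for every k, E_k → Ω in L¹, and sup_k P(E_k) < ∞. -/

import Mathlib

open MeasureTheory Metric Filter Set
open scoped ENNReal Topology NNReal

noncomputable section

/-- The divergence of a vector field `φ : ℝⁿ → ℝⁿ`. -/
def vdiv {n : ℕ} (φ : EuclideanSpace ℝ (Fin n) → EuclideanSpace ℝ (Fin n))
    (x : EuclideanSpace ℝ (Fin n)) : ℝ :=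
  ∑ i, fderiv ℝ φ x (EuclideanSpace.single i 1) i

/-- The relative perimeter `P(E; W)` of a set `E` in an open set `W`, defined variationally as
`sup { ∫_E div φ : φ ∈ C¹_c(W; ℝⁿ), ‖φ‖_∞ ≤ 1 }`. -/
def relPerimeter {n : ℕ} (E W : Set (EuclideanSpace ℝ (Fin n))) : ℝ≥0∞ :=
  ⨆ (φ : EuclideanSpace ℝ (Fin n) → EuclideanSpace ℝ (Fin n)) (_ : ContDiff ℝ 1 φ)
    (_ : HasCompactSupport φ) (_ : tsupport φ ⊆ W) (_ : ∀ x, ‖φ x‖ ≤ 1),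
    ENNReal.ofReal (∫ x in E, vdiv φ x)

/-- The perimeter `P(E)` of a set `E ⊆ ℝⁿ`:
`P(E) = sup { ∫_E div φ : φ ∈ C¹_c(ℝⁿ; ℝⁿ), ‖φ‖_∞ ≤ 1 }`. -/
def perimeter {n : ℕ} (E : Set (EuclideanSpace ℝ (Fin n))) : ℝ≥0∞ :=
  relPerimeter E Set.univ

/-- The set of points where `Ω` has Lebesgue density `α`; `densityPts Ω 1` is the
measure-theoretic interior `Ω¹` and `densityPts Ω 0` is the measure-theoretic exterior `Ω⁰`. -/
def densityPts {n : ℕ} (Ω : Set (EuclideanSpace ℝ (Fin n))) (α : ℝ≥0∞) :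
    Set (EuclideanSpace ℝ (Fin n)) :=
  {x | Tendsto (fun r : ℝ => volume (Ω ∩ ball x r) / volume (ball x r)) (𝓝[>] 0) (𝓝 α)}

/-- A smooth set: a bounded open set whose topological boundary is a smooth hypersurface,
expressed via a smooth defining function with nonvanishing differential on the boundary. -/
def IsSmoothSet {n : ℕ} (E : Set (EuclideanSpace ℝ (Fin n))) : Prop :=
  IsOpen E ∧ Bornology.IsBounded E ∧
  ∃ f : EuclideanSpace ℝ (Fin n) → ℝ, ContDiff ℝ (⊤ : ℕ∞) f ∧
    E = {x | f x < 0} ∧ frontier E = {x | f x = 0} ∧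
    ∀ x ∈ frontier E, fderiv ℝ f x ≠ 0

/-- `E ⋐ Ω` : the closure of `E` is compact and contained in `Ω`. -/
def CpctContained {n : ℕ} (E Ω : Set (EuclideanSpace ℝ (Fin n))) : Prop :=
  IsCompact (closure E) ∧ closure E ⊆ Ω

/-- `E_k → Ω` in `L¹`, i.e. `|E_k Δ Ω| → 0`. -/
def TendstoL1 {n : ℕ} (E : ℕ → Set (EuclideanSpace ℝ (Fin n)))
    (Ω : Set (EuclideanSpace ℝ (Fin n))) : Prop :=
  Tendsto (fun k => volume ((E k \ Ω) ∪ (Ω \ E k))) atTop (𝓝 0)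

/-- The volume `ω_n` of the unit ball in ℝⁿ. -/
def unitBallVol (n : ℕ) : ℝ≥0∞ := volume (ball (0 : EuclideanSpace ℝ (Fin n)) 1)

abbrev Eu (n : ℕ) := EuclideanSpace ℝ (Fin n)

/-- Admissible test fields. -/
structure IsTest {n : ℕ} (W : Set (Eu n)) (φ : Eu n → Eu n) : Prop where
  cd : ContDiff ℝ 1 φ
  cs : HasCompactSupport φ
  sub : tsupport φ ⊆ W
  le : ∀ x, ‖φ x‖ ≤ 1

lemma vdiv_smul {n : ℕ} {ψ : Eu n → ℝ} {φ : Eu n → Eu n} {x : Eu n}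
    (hψ : DifferentiableAt ℝ ψ x) (hφ : DifferentiableAt ℝ φ x) :
    vdiv (fun y => ψ y • φ y) x = ψ x * vdiv φ x + fderiv ℝ ψ x (φ x) := by
  unfold vdiv
  rw [fderiv_fun_smul hψ hφ]
  simp only [add_apply, smul_apply,
    ContinuousLinearMap.smulRight_apply, PiLp.add_apply, PiLp.smul_apply, smul_eq_mul,
    Finset.sum_add_distrib, Finset.mul_sum]
  congr 1
  have h : φ x = ∑ i, φ x i • (EuclideanSpace.single i (1:ℝ) : Eu n) := by
    ext j
    simp [Finset.sum_apply, Pi.single_apply]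
  conv_rhs => rw [h]
  rw [map_sum]
  refine Finset.sum_congr rfl fun i _ => ?_
  rw [map_smul, smul_eq_mul, mul_comm]

lemma vdiv_add {n : ℕ} {φ χ : Eu n → Eu n} {x : Eu n}
    (hχ : DifferentiableAt ℝ χ x) (hφ : DifferentiableAt ℝ φ x) :
    vdiv (fun y => φ y + χ y) x = vdiv φ x + vdiv χ x := by
  unfold vdiv
  rw [fderiv_fun_add hφ hχ]
  simp [Finset.sum_add_distrib]

lemma vdiv_sum {n : ℕ} {ι : Type*} (s : Finset ι) {φ : ι → Eu n → Eu n} {x : Eu n}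
    (hφ : ∀ i ∈ s, DifferentiableAt ℝ (φ i) x) :
    vdiv (fun y => ∑ i ∈ s, φ i y) x = ∑ i ∈ s, vdiv (φ i) x := by
  unfold vdiv
  rw [fderiv_fun_sum hφ]
  simp only [sum_apply]
  rw [Finset.sum_comm]
  refine Finset.sum_congr rfl fun i _ => ?_
  simp

lemma vdiv_neg {n : ℕ} {φ : Eu n → Eu n} {x : Eu n} :
    vdiv (fun y => - φ y) x = - vdiv φ x := by
  unfold vdiv
  rw [fderiv_fun_neg]
  simp

lemma vdiv_comp_add {n : ℕ} {φ : Eu n → Eu n} {x z : Eu n} :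
    vdiv (fun y => φ (y + z)) x = vdiv φ (x + z) := by
  unfold vdiv
  rw [fderiv_comp_add_right]

lemma vdiv_continuous {n : ℕ} {φ : Eu n → Eu n} (h : ContDiff ℝ 1 φ) : Continuous (vdiv φ) := by
  unfold vdiv
  have := h.continuous_fderiv (by norm_num)
  refine continuous_finsetSum _ fun i _ => ?_
  have h2 : Continuous fun x => (fderiv ℝ φ x) (EuclideanSpace.single i 1) := by fun_prop
  fun_prop

lemma vdiv_support {n : ℕ} {φ : Eu n → Eu n} : Function.support (vdiv φ) ⊆ tsupport φ := by
  intro x hx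
  by_contra h
  apply hx
  have : fderiv ℝ φ x = 0 := by
    by_contra h'
    exact h (support_fderiv_subset ℝ h')
  simp [vdiv, this]

lemma vdiv_hcs {n : ℕ} {φ : Eu n → Eu n} (h : HasCompactSupport φ) : HasCompactSupport (vdiv φ) :=
  h.mono' vdiv_support

lemma vdiv_integrable {n : ℕ} {φ : Eu n → Eu n} (h : ContDiff ℝ 1 φ) (h2 : HasCompactSupport φ) :
    Integrable (vdiv φ) :=
  (vdiv_continuous h).integrable_of_hasCompactSupport (vdiv_hcs h2)

lemma vdiv_bounded {n : ℕ} {φ : Eu n → Eu n} (h : ContDiff ℝ 1 φ) (h2 : HasCompactSupport φ) :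
    ∃ C : ℝ, 0 < C ∧ ∀ x, |vdiv φ x| ≤ C := by
  obtain ⟨C, hC⟩ := (vdiv_hcs h2).exists_bound_of_continuous (vdiv_continuous h)
  refine ⟨max C 1, by positivity, fun x => (hC x).trans (le_max_left _ _)⟩

/-- Integration by parts. -/
lemma integral_mul_vdiv {n : ℕ} {u : Eu n → ℝ} {φ : Eu n → Eu n} (hu : ContDiff ℝ 1 u)
    (h : ContDiff ℝ 1 φ) (h2 : HasCompactSupport φ) :
    ∫ x, u x * vdiv φ x = - ∫ x, fderiv ℝ u x (φ x) := by
  have hud : Differentiable ℝ u := hu.differentiable (by norm_num)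
  have hpd : Differentiable ℝ φ := h.differentiable (by norm_num)
  have hzero : ∫ x, vdiv (fun y => u y • φ y) x = 0 := by
    have hc : ContDiff ℝ 1 (fun y => u y • φ y) := hu.smul h
    have hs : HasCompactSupport (fun y => u y • φ y) := h2.smul_left (f := u)
    set g := fun y => u y • φ y with hg
    have hd : Differentiable ℝ g := hc.differentiable (by norm_num)
    unfold vdiv
    rw [integral_finsetSum]
    · refine Finset.sum_eq_zero fun i _ => ?_
      have hci : ContDiff ℝ 1 (fun y => g y i) := by fun_prop
      have hsi : HasCompactSupport (fun y => g y i) :=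
        hs.mono (fun x hx hx' => hx (by simp [hx']))
      have e : ∀ x, (fderiv ℝ g x (EuclideanSpace.single i 1)) i
          = fderiv ℝ (fun y => g y i) x (EuclideanSpace.single i 1) := by
        intro x
        have : HasFDerivAt (fun y => g y i) ((EuclideanSpace.proj i).comp (fderiv ℝ g x)) x :=
          (EuclideanSpace.proj (𝕜 := ℝ) i).hasFDerivAt.comp x (hd x).hasFDerivAt
        rw [this.fderiv]; rfl
      simp_rw [e]
      have hcont : Continuous fun x => fderiv ℝ (fun y => g y i) x (EuclideanSpace.single i 1) := by
        have := hci.continuous_fderiv (by norm_num)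
        fun_prop
      have := integral_mul_fderiv_eq_neg_fderiv_mul_of_integrable (μ := (volume : Measure (Eu n)))
        (f := fun _ => (1:ℝ)) (g := fun y => g y i) (v := EuclideanSpace.single i 1)
        (by simp) (by
          simp only [one_mul]
          exact hcont.integrable_of_hasCompactSupport (hsi.fderiv_apply ℝ _))
        (by simpa using hci.continuous.integrable_of_hasCompactSupport hsi)
        (by intros; fun_prop) (fun x _ => (hci.differentiable (by norm_num)) x)
      simpa using this
    · intro i _
      have h3 := hc.continuous_fderiv (by norm_num)
      have h4 : Continuous fun x => (fderiv ℝ g x) (EuclideanSpace.single i 1) := by fun_prop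
      refine Continuous.integrable_of_hasCompactSupport (by fun_prop) ?_
      refine (hs.fderiv_apply ℝ (EuclideanSpace.single i 1)).mono fun x hx hx' => hx (by simp [hx'])
  have hc1 : Continuous fun x => fderiv ℝ u x (φ x) := by
    have := hu.continuous_fderiv (by norm_num)
    have := h.continuous
    fun_prop
  have i1 : Integrable fun x => fderiv ℝ u x (φ x) := by
    refine hc1.integrable_of_hasCompactSupport (h2.mono fun x hx hx' => hx (by simp [hx']))
  have i2 : Integrable fun x => u x * vdiv φ x :=
    (hu.continuous.mul (vdiv_continuous h)).integrable_of_hasCompactSupport ((vdiv_hcs h2).mul_left)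
  have e : ∀ x, vdiv (fun y => u y • φ y) x = u x * vdiv φ x + fderiv ℝ u x (φ x) := fun x =>
    vdiv_smul (hud x) (hpd x)
  simp_rw [e] at hzero
  rw [integral_add i2 i1] at hzero
  linarith

lemma IsTest.neg {n : ℕ} {W : Set (Eu n)} {φ : Eu n → Eu n} (h : IsTest W φ) :
    IsTest W (fun x => - φ x) :=
  ⟨h.cd.neg, h.cs.mono (fun x hx hx' => hx (by simp [hx'])), by
    refine (closure_mono ?_).trans h.sub
    intro x hx hx'; exact hx (by simp [hx']), by simpa using h.le⟩

lemma integral_vdiv_zero {n : ℕ} {φ : Eu n → Eu n} (h : ContDiff ℝ 1 φ) (h2 : HasCompactSupport φ) :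
    ∫ x, vdiv φ x = 0 := by
  have := integral_mul_vdiv (u := fun _ => (1:ℝ)) contDiff_const h h2
  simpa using this

lemma integral_compl_vdiv {n : ℕ} {φ : Eu n → Eu n} {A : Set (Eu n)} (hA : MeasurableSet A)
    (h : ContDiff ℝ 1 φ) (h2 : HasCompactSupport φ) :
    ∫ x in Aᶜ, vdiv φ x = - ∫ x in A, vdiv φ x := by
  have := integral_add_compl hA (vdiv_integrable h h2)
  rw [integral_vdiv_zero h h2] at this
  linarith

/-- real-valued bound version of perimeter bound -/
lemma perimeter_le_iff {n : ℕ} {A : Set (Eu n)} {M : ℝ} (hM : 0 ≤ M) :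
    perimeter A ≤ ENNReal.ofReal M ↔ ∀ φ, IsTest univ φ → ∫ x in A, vdiv φ x ≤ M := by
  unfold perimeter relPerimeter
  simp only [iSup_le_iff]
  constructor
  · intro h φ hφ
    have := h φ hφ.cd hφ.cs hφ.sub hφ.le
    rwa [ENNReal.ofReal_le_ofReal_iff hM] at this
  · intro h φ h1 h2 h3 h4
    exact ENNReal.ofReal_le_ofReal (h φ ⟨h1, h2, h3, h4⟩)

/-- Sum of test functions with disjoint supports. -/
lemma test_sum_le {n : ℕ} {A : Set (Eu n)} {M : ℝ}
    (hM : ∀ φ, IsTest univ φ → ∫ x in A, vdiv φ x ≤ M)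
    {ι : Type*} (s : Finset ι) (W : ι → Set (Eu n)) (hW : (s : Set ι).PairwiseDisjoint W)
    (φ : ι → Eu n → Eu n) (hφ : ∀ i ∈ s, IsTest (W i) (φ i)) :
    ∑ i ∈ s, ∫ x in A, vdiv (φ i) x ≤ M := by
  have hd : ∀ i ∈ s, ∀ x, DifferentiableAt ℝ (φ i) x := fun i hi x =>
    (hφ i hi).cd.differentiable (by norm_num) x
  have ht : IsTest univ (fun x => ∑ i ∈ s, φ i x) := by
    refine ⟨ContDiff.sum fun i hi => (hφ i hi).cd, ?_, subset_univ _, fun x => ?_⟩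
    · have hK : IsCompact (⋃ i ∈ s, tsupport (φ i)) := s.isCompact_biUnion fun i hi => (hφ i hi).cs
      refine HasCompactSupport.of_support_subset_isCompact hK fun x hx => ?_
      by_contra hx'
      apply hx
      simp only [mem_iUnion, not_exists] at hx'
      exact Finset.sum_eq_zero fun i hi => image_eq_zero_of_notMem_tsupport (hx' i hi)
    · by_cases hx : ∃ i ∈ s, φ i x ≠ 0
      · obtain ⟨i, hi, hix⟩ := hx
        rw [Finset.sum_eq_single_of_mem i hi]
        · exact (hφ i hi).le x
        · intro j hj hji
          by_contra hjx
          exact Set.disjoint_left.1 (hW hj hi hji) ((hφ j hj).sub (subset_tsupport _ hjx))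
            ((hφ i hi).sub (subset_tsupport _ hix))
      · push Not at hx
        rw [Finset.sum_eq_zero hx]; simp
  have h := hM _ ht
  simp_rw [vdiv_sum s (fun i hi => hd i hi _)] at h
  rwa [integral_finsetSum] at h
  exact fun i hi => (vdiv_integrable (hφ i hi).cd (hφ i hi).cs).integrableOn

lemma grad_bound {n : ℕ} {u : Eu n → ℝ} (hu : ContDiff ℝ 2 u) (hs : HasCompactSupport u) {M : ℝ}
    (hM : ∀ φ, IsTest univ φ → ∫ x, u x * vdiv φ x ≤ M) : ∫ x, ‖fderiv ℝ u x‖ ≤ M := by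
  have hu1 : ContDiff ℝ 1 u := hu.of_le (by norm_num)
  have hfc : Continuous (fderiv ℝ u) := hu1.continuous_fderiv (by norm_num)
  have hfcs : HasCompactSupport (fderiv ℝ u) := hs.fderiv ℝ
  have hnormInt : Integrable (fun x => ‖fderiv ℝ u x‖) :=
    (hfc.norm).integrable_of_hasCompactSupport hfcs.norm
  set K := tsupport u with hK
  have hKc : IsCompact K := hs
  have key : ∀ κ : ℝ, 0 < κ → ∫ x, ‖fderiv ℝ u x‖ ≤ M + κ * volume.real K := by
    intro κ hκ
    set G : Eu n → Eu n := fun x => (InnerProductSpace.toDual ℝ (Eu n)).symm (fderiv ℝ u x) with hG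
    have hGn : ∀ x, ‖G x‖ = ‖fderiv ℝ u x‖ := fun x => by simp [hG]
    have hGi : ∀ x v, fderiv ℝ u x v = inner ℝ (G x) v := fun x v => by simp [hG]
    have hGc : ContDiff ℝ 1 G := by
      have h1 : ContDiff ℝ 1 (fderiv ℝ u) := hu.fderiv_right (by norm_num)
      exact (InnerProductSpace.toDual ℝ (Eu n)).symm.toContinuousLinearEquiv.contDiff.comp h1
    set S : Eu n → ℝ := fun x => Real.sqrt (‖G x‖ ^ 2 + κ ^ 2) with hS
    have hSpos : ∀ x, 0 < S x := fun x => Real.sqrt_pos.2 (by positivity)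
    have hSc : ContDiff ℝ 1 S := (hGc.norm_sq ℝ |>.add contDiff_const).sqrt (fun x => by positivity)
    have hSG : ∀ x, ‖G x‖ ≤ S x := fun x => Real.le_sqrt_of_sq_le (by nlinarith)
    have hSG2 : ∀ x, S x ≤ ‖G x‖ + κ := fun x => by
      refine (Real.sqrt_le_left (by positivity)).2 ?_
      nlinarith [norm_nonneg (G x)]
    set φ : Eu n → Eu n := fun x => (-(S x)⁻¹) • G x with hφ
    have hG0 : ∀ x, x ∉ K → G x = 0 := by
      intro x hx
      have : fderiv ℝ u x = 0 := by
        by_contra h'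
        exact hx (support_fderiv_subset ℝ h')
      simp [hG, this]
    have ht : IsTest univ φ := by
      refine ⟨((hSc.inv fun x => (hSpos x).ne').neg).smul hGc, ?_, subset_univ _, fun x => ?_⟩
      · refine HasCompactSupport.of_support_subset_isCompact hKc fun x hx => ?_
        by_contra h'
        exact hx (by simp [hφ, hG0 x h'])
      · simp only [hφ, norm_smul, norm_neg, norm_inv, Real.norm_eq_abs, abs_of_pos (hSpos x)]
        rw [inv_mul_le_iff₀ (hSpos x), mul_one]
        exact hSG x
    have h := hM φ ht
    rw [integral_mul_vdiv hu1 ht.cd ht.cs, ← integral_neg] at h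
    have hle : ∀ x, ‖fderiv ℝ u x‖ - K.indicator (fun _ => κ) x ≤ -(fderiv ℝ u x (φ x)) := by
      intro x
      by_cases hx : x ∈ K
      · rw [hGi, ← hGn]
        simp only [hφ, inner_smul_right, indicator_of_mem hx, real_inner_self_eq_norm_sq]
        rw [neg_mul, neg_neg, inv_mul_eq_div, le_div_iff₀ (hSpos x)]
        nlinarith [hSG x, hSG2 x, norm_nonneg (G x), hSpos x]
      · rw [← hGn]
        simp [hφ, hG0 x hx, hx]
    have hi2 : Integrable (K.indicator (fun _ => κ)) (volume : Measure (Eu n)) :=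
      (integrable_indicator_iff hKc.measurableSet).2
        (integrableOn_const hKc.measure_lt_top.ne (by simp))
    have hi3 : Integrable (fun x => -(fderiv ℝ u x (φ x))) := by
      have hc : Continuous fun x => -(fderiv ℝ u x (φ x)) := by
        have := ht.cd.continuous
        fun_prop
      refine hc.integrable_of_hasCompactSupport (ht.cs.mono fun x hx hx' => hx (by simp [hx']))
    have h2 := integral_mono (hnormInt.sub hi2) hi3 hle
    rw [integral_sub' hnormInt hi2, integral_indicator hKc.measurableSet, setIntegral_const] at h2
    simp only [smul_eq_mul] at h2
    linarith
  refine le_of_forall_pos_le_add fun ε hε => ?_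
  have h := key (ε / (volume.real K + 1)) (by positivity)
  refine h.trans ?_
  have : ε / (volume.real K + 1) * volume.real K ≤ ε := by
    rw [div_mul_eq_mul_div, div_le_iff₀ (by positivity)]
    nlinarith [measureReal_nonneg (μ := (volume : Measure (Eu n))) (s := K)]
  linarith

open ContinuousLinearMap in
lemma moll_bound {n : ℕ} {g : Eu n → ℝ} (hg : Integrable g) (hgs : HasCompactSupport g) {M : ℝ}
    (hM : ∀ φ, IsTest univ φ → ∫ x, g x * vdiv φ x ≤ M) (ρ : ContDiffBump (0 : Eu n)) :
    ∫ x, ‖fderiv ℝ (convolution (ρ.normed volume) g (lsmul ℝ ℝ) volume) x‖ ≤ M := by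
  have hc : ContDiff ℝ 2 (convolution (ρ.normed volume) g (lsmul ℝ ℝ) volume) :=
    HasCompactSupport.contDiff_convolution_left _ ρ.hasCompactSupport_normed
      ρ.contDiff_normed hg.locallyIntegrable
  refine grad_bound hc (HasCompactSupport.convolution _ ρ.hasCompactSupport_normed hgs) ?_
  intro φ hφ
  have hρi : Integrable (ρ.normed (volume : Measure (Eu n))) :=
    ρ.continuous_normed.integrable_of_hasCompactSupport ρ.hasCompactSupport_normed
  have hI := hρi.convolution_integrand (lsmul ℝ ℝ) hg
  obtain ⟨C, hC0, hC⟩ := vdiv_bounded hφ.cd hφ.cs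
  have hI2 : Integrable (fun p : Eu n × Eu n => (ρ.normed volume p.2 * g (p.1 - p.2)) * vdiv φ p.1)
      (volume.prod volume) := by
    refine Integrable.mul_bdd (c := C) (by simpa using hI) ?_ (ae_of_all _ fun p => hC p.1)
    exact ((vdiv_continuous hφ.cd).comp continuous_fst).aestronglyMeasurable
  have e1 : ∀ x, convolution (ρ.normed volume) g (lsmul ℝ ℝ) volume x * vdiv φ x
      = ∫ z, (ρ.normed volume z * g (x - z)) * vdiv φ x := by
    intro x
    rw [convolution_def, ← integral_mul_const]
    simp
  simp_rw [e1]
  rw [integral_integral_swap hI2]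
  have e2 : ∀ z, ∫ x, (ρ.normed volume z * g (x - z)) * vdiv φ x
      = ρ.normed volume z * ∫ x, g x * vdiv φ (x + z) := by
    intro z
    rw [← integral_const_mul, ← integral_sub_right_eq_self (fun x => ρ.normed volume z * (g x * vdiv φ (x + z))) z]
    refine integral_congr_ae (ae_of_all _ fun x => ?_)
    simp; ring
  have hi2 := hI2.integral_prod_right
  calc ∫ z, ∫ x, (ρ.normed volume z * g (x - z)) * vdiv φ x
      ≤ ∫ z, ρ.normed volume z * M := by
        refine integral_mono hi2 (hρi.mul_const M) fun z => ?_
        simp only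
        rw [e2]
        refine mul_le_mul_of_nonneg_left ?_ (ρ.nonneg_normed z)
        have ht : IsTest univ (fun x => φ (x + z)) :=
          ⟨hφ.cd.comp (contDiff_id.add contDiff_const),
            hφ.cs.comp_homeomorph (Homeomorph.addRight z), subset_univ _, fun x => hφ.le _⟩
        have := hM _ ht
        simpa [vdiv_comp_add] using this
    _ = M := by rw [integral_mul_const, ρ.integral_normed, one_mul]

lemma exists_cutoff (n : ℕ) : ∃ C : ℝ, 0 < C ∧ ∀ (x : Eu n) (r : ℝ), 0 < r →
    ∃ η : Eu n → ℝ, ContDiff ℝ (⊤ : ℕ∞) η ∧ (∀ y, 0 ≤ η y ∧ η y ≤ 1) ∧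
      (∀ y ∈ closedBall x r, η y = 1) ∧ tsupport η ⊆ ball x (2 * r) ∧
      ∀ y, ‖fderiv ℝ η y‖ ≤ C / r := by
  let b : ContDiffBump (0 : Eu n) := ⟨1, 3/2, by norm_num, by norm_num⟩
  have hb : ContDiff ℝ (⊤ : ℕ∞) b := b.contDiff
  have hb1 : ContDiff ℝ 1 b := b.contDiff
  obtain ⟨C, hC⟩ := (b.hasCompactSupport.fderiv ℝ).exists_bound_of_continuous
    (hb1.continuous_fderiv (by norm_num))
  refine ⟨max C 1, by positivity, fun x r hr => ?_⟩
  have hsm : ContDiff ℝ (⊤ : ℕ∞) (fun y : Eu n => r⁻¹ • (y - x)) :=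
    by fun_prop
  refine ⟨fun y => b (r⁻¹ • (y - x)), hb.comp hsm, fun y => ⟨b.nonneg, b.le_one⟩, ?_, ?_, ?_⟩
  · intro y hy
    refine b.one_of_mem_closedBall ?_
    rw [mem_closedBall, dist_eq_norm] at hy
    rw [mem_closedBall, dist_zero_right, norm_smul, norm_inv, Real.norm_eq_abs, abs_of_pos hr,
      inv_mul_le_iff₀ hr]
    show ‖y - x‖ ≤ r * 1
    linarith
  · have : Function.support (fun y => b (r⁻¹ • (y - x))) ⊆ closedBall x (3/2 * r) := by
      intro y hy
      have hy2 : r⁻¹ • (y - x) ∈ Function.support b := hy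
      rw [b.support_eq, mem_ball, dist_zero_right, norm_smul, norm_inv, Real.norm_eq_abs,
        abs_of_pos hr, inv_mul_lt_iff₀ hr] at hy2
      rw [mem_closedBall, dist_eq_norm]
      have h3 : r * b.rOut = r * (3/2) := rfl
      rw [h3] at hy2
      linarith
    refine (closure_minimal this isClosed_closedBall).trans (closedBall_subset_ball ?_)
    linarith
  · intro y
    have hd : HasFDerivAt (fun y : Eu n => r⁻¹ • (y - x)) (r⁻¹ • ContinuousLinearMap.id ℝ (Eu n)) y :=
      ((hasFDerivAt_id y).sub_const x).const_smul r⁻¹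
    have hd2 := ((hb1.differentiable (by norm_num)) (r⁻¹ • (y - x))).hasFDerivAt.comp y hd
    have e : fderiv ℝ (fun y => b (r⁻¹ • (y - x))) y = r⁻¹ • fderiv ℝ b (r⁻¹ • (y - x)) := by
      rw [show (fun y => b (r⁻¹ • (y - x))) = (b ∘ fun y : Eu n => r⁻¹ • (y - x)) from rfl, hd2.fderiv]
      ext v; simp
    rw [e, norm_smul, norm_inv, Real.norm_eq_abs, abs_of_pos hr, inv_mul_eq_div]
    gcongr
    exact (hC _).trans (le_max_left _ _)

lemma vol_ball_real {n : ℕ} (x : Eu n) {r : ℝ} (hr : 0 < r) :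
    volume.real (ball x r) = r ^ n * volume.real (ball (0 : Eu n) 1) := by
  have := Measure.addHaar_ball_of_pos (volume : Measure (Eu n)) x hr
  rw [measureReal_def, this, ENNReal.toReal_mul, ENNReal.toReal_ofReal (by positivity)]
  simp [measureReal_def]

lemma vol_ball_pos {n : ℕ} (x : Eu n) {r : ℝ} (hr : 0 < r) : 0 < volume.real (ball x r) :=
  ENNReal.toReal_pos (measure_ball_pos volume x hr).ne' measure_ball_lt_top.ne

/-- product rule under the integral sign -/
lemma integral_cut {n : ℕ} {A : Set (Eu n)} {η : Eu n → ℝ} {φ : Eu n → Eu n}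
    (hη : ContDiff ℝ 1 η) (h : ContDiff ℝ 1 φ) (h2 : HasCompactSupport φ) :
    ∫ x in A, η x * vdiv φ x
      = (∫ x in A, vdiv (fun y => η y • φ y) x) - ∫ x in A, fderiv ℝ η x (φ x) := by
  have i1 : Integrable (vdiv (fun y => η y • φ y)) := vdiv_integrable (hη.smul h) (h2.smul_left (f := η))
  have hc : Continuous fun x => fderiv ℝ η x (φ x) := by
    have := hη.continuous_fderiv (by norm_num)
    have := h.continuous
    fun_prop
  have i2 : Integrable fun x => fderiv ℝ η x (φ x) :=
    hc.integrable_of_hasCompactSupport (h2.mono fun x hx hx' => hx (by simp [hx']))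
  rw [← integral_sub i1.integrableOn i2.integrableOn]
  refine integral_congr_ae (ae_of_all _ fun x => ?_)
  have := vdiv_smul (hη.differentiable (by norm_num) x) (h.differentiable (by norm_num) x)
  simp only [this]; ring

open ContinuousLinearMap in
/-- Gagliardo-Nirenberg-Sobolev for `BV` -/
lemma gns_bv (n : ℕ) (hn : 2 ≤ n) : ∃ C : ℝ, 0 < C ∧ ∀ (g : Eu n → ℝ), Integrable g →
    HasCompactSupport g → ∀ M : ℝ, (∀ φ, IsTest univ φ → ∫ x, g x * vdiv φ x ≤ M) →
    ∀ A : Set (Eu n), MeasurableSet A → (∀ x ∈ A, g x = 1) → volume A ≠ ⊤ →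
    (volume.real A) ^ (((n : ℝ) - 1) / n) ≤ C * M := by
  have hn1 : (1 : ℝ) < n := by exact_mod_cast hn
  set p : ℝ≥0 := Real.toNNReal (n / ((n:ℝ) - 1)) with hp
  have hpr : (p : ℝ) = n / ((n:ℝ) - 1) := Real.coe_toNNReal _ (by
    apply div_nonneg <;> linarith)
  have hconj : NNReal.HolderConjugate (Module.finrank ℝ (Eu n)) p := by
    rw [← NNReal.holderConjugate_coe_iff, hpr]
    simp only [finrank_euclideanSpace, Fintype.card_fin, NNReal.coe_natCast]
    rw [Real.holderConjugate_iff]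
    refine ⟨hn1, ?_⟩
    have : (n : ℝ) - 1 ≠ 0 := by linarith
    field_simp
    ring
  have hp0 : (0:ℝ) < p := by rw [hpr]; apply div_pos <;> linarith
  set C0 : ℝ≥0 := eLpNormLESNormFDerivOneConst (volume : Measure (Eu n)) p with hC0
  refine ⟨C0 + 1, by positivity, fun g hg hgs M hM A hA hA1 hAt => ?_⟩
  have hM0 : 0 ≤ M := by
    have h0 : IsTest (univ : Set (Eu n)) (fun _ => 0) :=
      ⟨contDiff_const, HasCompactSupport.zero, subset_univ _, by simp⟩
    have := hM _ h0
    simpa [vdiv] using this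
  let ρ : ℕ → ContDiffBump (0 : Eu n) := fun k =>
    ⟨1 / (2 * ((k:ℝ) + 1)), 1 / ((k:ℝ) + 1), by positivity, by
      apply one_div_lt_one_div_of_lt <;> linarith [(Nat.cast_nonneg k : (0:ℝ) ≤ k)]⟩
  have hρ0 : Tendsto (fun k => (ρ k).rOut) atTop (𝓝 0) := tendsto_one_div_add_atTop_nhds_zero_nat
  have hlim := ContDiffBump.ae_convolution_tendsto_right_of_locallyIntegrable (K := 2)
    (μ := (volume : Measure (Eu n))) hρ0
    (Eventually.of_forall fun k => by
      show 1 / ((k:ℝ) + 1) ≤ 2 * (1 / (2 * ((k:ℝ) + 1)))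
      have : (0:ℝ) < (k:ℝ) + 1 := by positivity
      field_simp; exact le_refl _) hg.locallyIntegrable
  have hcd : ∀ k, ContDiff ℝ 1 (convolution ((ρ k).normed volume) g (lsmul ℝ ℝ) volume) := fun k =>
    HasCompactSupport.contDiff_convolution_left _ (ρ k).hasCompactSupport_normed
      (ρ k).contDiff_normed hg.locallyIntegrable
  have hcs : ∀ k, HasCompactSupport (convolution ((ρ k).normed volume) g (lsmul ℝ ℝ) volume) :=
    fun k => HasCompactSupport.convolution _ (ρ k).hasCompactSupport_normed hgs
  have hb : ∀ k, eLpNorm (convolution ((ρ k).normed volume) g (lsmul ℝ ℝ) volume) p volume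
      ≤ C0 * ENNReal.ofReal M := by
    intro k
    refine (eLpNorm_le_eLpNorm_fderiv_one volume (hcd k) (hcs k) hconj).trans ?_
    gcongr
    rw [eLpNorm_one_eq_lintegral_enorm, ← ofReal_integral_norm_eq_lintegral_enorm]
    · exact ENNReal.ofReal_le_ofReal (moll_bound hg hgs hM (ρ k))
    · exact ((hcd k).continuous_fderiv (by norm_num)).integrable_of_hasCompactSupport
        ((hcs k).fderiv ℝ)
  have hfat := Lp.eLpNorm_lim_le_liminf_eLpNorm (p := (p : ℝ≥0∞))
    (fun k => (hcd k).continuous.aestronglyMeasurable) g hlim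
  have h1 : eLpNorm g p volume ≤ C0 * ENNReal.ofReal M :=
    hfat.trans (liminf_le_of_frequently_le' (Frequently.of_forall hb))
  have h2 : eLpNorm (A.indicator fun _ => (1:ℝ)) p volume ≤ eLpNorm g p volume := by
    refine eLpNorm_mono fun x => ?_
    by_cases hx : x ∈ A
    · simp [hx, hA1 x hx]
    · simp [hx]
  have hp0' : (p : ℝ≥0∞) ≠ 0 := by
    intro h; simp at h; simp [h] at hp0
  rw [eLpNorm_indicator_const hA hp0' (by simp)] at h2
  have h3 := h2.trans h1
  simp only [enorm_one, one_mul, ENNReal.coe_toReal] at h3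
  have h4 := ENNReal.toReal_mono (by finiteness) h3
  rw [← ENNReal.toReal_rpow, ENNReal.toReal_mul, ENNReal.toReal_ofReal hM0, ENNReal.coe_toReal, hpr,
    one_div_div] at h4
  refine h4.trans ?_
  nlinarith

lemma abs_setIntegral_le {n : ℕ} {A B : Set (Eu n)} (hA : MeasurableSet A)
    {f : Eu n → ℝ} {c : ℝ} (hB' : volume B ≠ ⊤) (hf : ∀ x, |f x| ≤ c)
    (h0 : ∀ x, x ∉ B → f x = 0) : |∫ x in A, f x| ≤ c * volume.real (A ∩ B) := by
  have : ∫ x in A, f x = ∫ x in A ∩ B, f x := by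
    refine setIntegral_eq_of_subset_of_forall_sdiff_eq_zero hA inter_subset_left
      fun x hx => h0 x fun hB => hx.2 ⟨hx.1, hB⟩
  rw [this, ← Real.norm_eq_abs]
  refine norm_setIntegral_le_of_norm_le_const ?_ (fun x _ => hf x)
  exact (measure_mono inter_subset_right).trans_lt hB'.lt_top

lemma iso (n : ℕ) (hn : 2 ≤ n) (K : ℝ) (hK : 0 < K) : ∃ τ₀ : ℝ, 0 < τ₀ ∧ ∀ τ, 0 < τ → τ ≤ τ₀ →
    ∀ (A : Set (Eu n)), MeasurableSet A → ∀ (x : Eu n) (r : ℝ), 0 < r →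
    τ * r ^ n ≤ volume.real (A ∩ ball x r) →
    volume.real (A ∩ ball x (4 * r)) ≤ 2 * τ * (4 * r) ^ n →
    ∃ φ, IsTest (ball x (2 * r)) φ ∧ K * τ * r ^ (n - 1) ≤ ∫ y in A, vdiv φ y := by
  obtain ⟨C, hC, hcut⟩ := exists_cutoff n
  obtain ⟨C', hC', hgns⟩ := gns_bv n hn
  set D : ℝ := C' * (K + C * (2 * 4 ^ n)) with hD
  have hDpos : 0 < D := by positivity
  have hn0 : (0:ℝ) < n := by exact_mod_cast (by omega : 0 < n)
  refine ⟨(1 / (2 * D)) ^ n, by positivity, fun τ hτ hτ0 A hA x r hr h1 h2 => ?_⟩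
  by_contra hcon
  push Not at hcon
  obtain ⟨η, hη, hη01, hη1, hηs, hηd⟩ := hcut x r hr
  have hη' : ContDiff ℝ 1 η := hη.of_le (by exact_mod_cast le_top)
  have hηcs : HasCompactSupport η :=
    HasCompactSupport.of_support_subset_isCompact (isCompact_closedBall x (2 * r))
      ((subset_tsupport _).trans (hηs.trans ball_subset_closedBall))
  have hgi : Integrable (A.indicator η) :=
    (hη.continuous.integrable_of_hasCompactSupport hηcs).indicator hA
  have hgcs : HasCompactSupport (A.indicator η) := hηcs.mono (by
    intro y hy hy'; exact hy (by simp [indicator, hy']))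
  have hrn : r ^ n = r ^ (n - 1) * r := by rw [← pow_succ]; congr 1; omega
  have key := hgns (A.indicator η) hgi hgcs ((K + C * (2 * 4 ^ n)) * τ * r ^ (n - 1)) (by
    intro φ hφ
    have e : ∫ y, A.indicator η y * vdiv φ y = ∫ y in A, η y * vdiv φ y := by
      rw [← integral_indicator hA]
      refine integral_congr_ae (ae_of_all _ fun y => ?_)
      by_cases hy : y ∈ A <;> simp [hy]
    rw [e, integral_cut hη' hφ.cd hφ.cs]
    have t1 : IsTest (ball x (2 * r)) (fun y => η y • φ y) := by
      refine ⟨hη'.smul hφ.cd, hφ.cs.smul_left (f := η), (closure_mono ?_).trans hηs, fun y => ?_⟩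
      · intro y hy hy'; exact hy (by simp [hy'])
      · rw [norm_smul, Real.norm_eq_abs, abs_of_nonneg (hη01 y).1]
        exact mul_le_one₀ (hη01 y).2 (norm_nonneg _) (hφ.le y)
    have b1 := hcon _ t1
    have b2 := abs_setIntegral_le (A := A) (B := ball x (4 * r)) hA
      (f := fun y => fderiv ℝ η y (φ y)) (c := C / r) measure_ball_lt_top.ne (fun y => by
        refine ((fderiv ℝ η y).le_opNorm _).trans ?_
        calc _ ≤ (C / r) * 1 := mul_le_mul (hηd y) (hφ.le y) (norm_nonneg _) (by positivity)
          _ = _ := mul_one _) (fun y hy => by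
        have : fderiv ℝ η y = 0 := by
          by_contra h'
          exact hy (ball_subset_ball (by linarith) (hηs (support_fderiv_subset ℝ h')))
        simp [this])
    have b3 : C / r * volume.real (A ∩ ball x (4 * r)) ≤ C * (2 * 4 ^ n) * τ * r ^ (n - 1) := by
      calc _ ≤ C / r * (2 * τ * (4 * r) ^ n) := by gcongr
        _ = _ := by rw [mul_pow, hrn]; field_simp
    have := (abs_le.1 b2).1
    linarith) (A ∩ ball x r) (hA.inter measurableSet_ball) (fun y hy => by
      rw [indicator_of_mem hy.1]; exact hη1 y (ball_subset_closedBall hy.2))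
      ((measure_mono inter_subset_right).trans_lt measure_ball_lt_top).ne
  have k1 : (τ * r ^ n) ^ (((n : ℝ) - 1) / n) ≤ D * τ * r ^ (n - 1) := by
    refine (Real.rpow_le_rpow (by positivity) h1 ?_).trans (key.trans_eq (by rw [hD]; ring))
    apply div_nonneg _ hn0.le
    have : (2:ℝ) ≤ n := by exact_mod_cast hn
    linarith
  have k2 : (τ * r ^ n) ^ (((n : ℝ) - 1) / n) = τ ^ (((n : ℝ) - 1) / n) * r ^ (n - 1) := by
    rw [Real.mul_rpow hτ.le (by positivity), ← Real.rpow_natCast r n, ← Real.rpow_mul hr.le,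
      mul_div_cancel₀ _ hn0.ne', ← Real.rpow_natCast r (n-1), Nat.cast_sub (by omega)]
    simp
  rw [k2] at k1
  have k3 : τ ^ (((n : ℝ) - 1) / n) ≤ D * τ := le_of_mul_le_mul_right k1 (by positivity)
  set s := τ ^ (((n : ℝ) - 1) / n) with hs
  have hspos : 0 < s := Real.rpow_pos_of_pos hτ _
  have k4 : τ = s * τ ^ (1 / (n:ℝ)) := by
    rw [hs, ← Real.rpow_add hτ, ← add_div]
    simp [hn0.ne']
  have k5 : τ ^ (1 / (n:ℝ)) ≤ 1 / (2 * D) := by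
    calc _ ≤ ((1 / (2 * D)) ^ n) ^ (1 / (n:ℝ)) := Real.rpow_le_rpow hτ.le hτ0 (by positivity)
      _ = _ := by
        rw [← Real.rpow_natCast, ← Real.rpow_mul (by positivity), mul_one_div_cancel hn0.ne',
          Real.rpow_one]
  have k6 : D * τ ≤ s * (1/2) := by
    calc D * τ = s * (D * τ ^ (1 / (n:ℝ))) := by rw [mul_left_comm, ← k4]
      _ ≤ s * (D * (1 / (2 * D))) := by gcongr
      _ = _ := by field_simp
  linarith

/-- finite products of cutoffs -/
lemma exists_multi_cutoff (n : ℕ) : ∃ C : ℝ, 0 < C ∧ ∀ {ι : Type} (s : Finset ι) (x : ι → Eu n)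
    (r : ι → ℝ), (∀ i ∈ s, 0 < r i) →
    ∃ ψ : Eu n → ℝ, ContDiff ℝ (⊤ : ℕ∞) ψ ∧ (∀ y, 0 ≤ ψ y ∧ ψ y ≤ 1) ∧
      (∀ i ∈ s, ∀ y ∈ closedBall (x i) (r i), ψ y = 0) ∧
      (∀ y, (∀ i ∈ s, y ∉ ball (x i) (2 * r i)) → ψ y = 1) ∧
      ∀ y, ‖fderiv ℝ ψ y‖ ≤ ∑ i ∈ s, (ball (x i) (2 * r i)).indicator (fun _ => C / r i) y := by
  obtain ⟨C, hC, hcut⟩ := exists_cutoff n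
  refine ⟨C, hC, ?_⟩
  intro ι s x r
  classical
  induction s using Finset.induction_on with
  | empty =>
    intro _
    exact ⟨fun _ => 1, contDiff_const, by simp, by simp, by simp, by simp⟩
  | insert i s hi ih =>
    intro hr
    obtain ⟨ψ, h1, h2, h3, h4, h5⟩ := ih fun j hj => hr j (Finset.mem_insert_of_mem hj)
    obtain ⟨η, g1, g2, g3, g4, g5⟩ := hcut (x i) (r i) (hr i (Finset.mem_insert_self _ _))
    have hd1 : Differentiable ℝ ψ := h1.differentiable (by simp)
    have hd2 : Differentiable ℝ η := g1.differentiable (by simp)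
    refine ⟨fun y => (1 - η y) * ψ y, (contDiff_const.sub g1).mul h1, fun y => ?_, ?_, ?_, ?_⟩
    · have := h2 y; have := g2 y
      exact ⟨mul_nonneg (by linarith) (by linarith), mul_le_one₀ (by linarith) (by linarith) (by linarith)⟩
    · intro j hj y hy
      rcases Finset.mem_insert.1 hj with rfl | hj
      · simp [g3 y hy]
      · simp [h3 j hj y hy]
    · intro y hy
      have a1 := h4 y fun j hj => hy j (Finset.mem_insert_of_mem hj)
      have a2 : η y = 0 := by
        refine image_eq_zero_of_notMem_tsupport fun h => ?_
        exact hy i (Finset.mem_insert_self _ _) (g4 h)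
      simp [a1, a2]
    · intro y
      rw [Finset.sum_insert hi, fderiv_fun_mul (by fun_prop) (hd1 y), fderiv_const_sub]
      refine (norm_add_le _ _).trans ?_
      rw [add_comm, norm_smul, norm_smul, norm_neg, Real.norm_eq_abs, Real.norm_eq_abs,
        abs_of_nonneg (h2 y).1, abs_of_nonneg (by linarith [(g2 y).2] : 0 ≤ 1 - η y)]
      have b1 : ‖fderiv ℝ η y‖ ≤ (ball (x i) (2 * r i)).indicator (fun _ => C / r i) y := by
        by_cases hy : y ∈ ball (x i) (2 * r i)
        · rw [indicator_of_mem hy]; exact g5 y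
        · have : fderiv ℝ η y = 0 := by
            by_contra h'
            exact hy (g4 (support_fderiv_subset ℝ h'))
          simp [this, hy]
      refine add_le_add ?_ ?_
      · refine le_trans ?_ b1
        exact mul_le_of_le_one_left (norm_nonneg _) (h2 y).2
      · refine le_trans ?_ (h5 y)
        exact mul_le_of_le_one_left (norm_nonneg _) (by linarith [(g2 y).1])

lemma abs_setIntegral_le_sum {n : ℕ} {A : Set (Eu n)} {ι : Type*} (s : Finset ι)
    (B : ι → Set (Eu n)) (hB : ∀ i ∈ s, MeasurableSet (B i)) (hBt : ∀ i ∈ s, volume (B i) ≠ ⊤)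
    (c : ι → ℝ) {f : Eu n → ℝ} (hf : ∀ x, |f x| ≤ ∑ i ∈ s, (B i).indicator (fun _ => c i) x) :
    |∫ x in A, f x| ≤ ∑ i ∈ s, c i * volume.real (A ∩ B i) := by
  have hi : ∀ i ∈ s, Integrable ((B i).indicator (fun _ => c i)) (volume : Measure (Eu n)) :=
    fun i his => (integrable_indicator_iff (hB i his)).2 (integrableOn_const (hBt i his) (by simp))
  have hI : IntegrableOn (fun x => ∑ i ∈ s, (B i).indicator (fun _ => c i) x) A volume :=
    (integrable_finsetSum s hi).integrableOn
  rw [← Real.norm_eq_abs]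
  refine (norm_integral_le_of_norm_le hI (ae_of_all _ hf)).trans_eq ?_
  rw [integral_finsetSum _ fun i his => (hi i his).integrableOn]
  refine Finset.sum_congr rfl fun i his => ?_
  rw [integral_indicator (hB i his), Measure.restrict_restrict (hB i his), setIntegral_const,
    smul_eq_mul, mul_comm, inter_comm]

lemma key_sum (n : ℕ) (hn : 2 ≤ n) : ∃ τ₀ : ℝ, 0 < τ₀ ∧ ∀ (A : Set (Eu n)), MeasurableSet A →
    ∀ M : ℝ, (∀ φ, IsTest univ φ → ∫ x in A, vdiv φ x ≤ M) → ∀ τ, 0 < τ → τ ≤ τ₀ →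
    ∀ η, 0 < η → ∃ δ, 0 < δ ∧ ∀ {ι : Type} (s : Finset ι) (x : ι → Eu n) (r : ι → ℝ),
      (∀ i ∈ s, 0 < r i ∧ r i ≤ δ) →
      ((s : Set ι).PairwiseDisjoint fun i => ball (x i) (2 * r i)) →
      (∀ i ∈ s, τ * r i ^ n ≤ volume.real (A ∩ ball (x i) (r i)) ∧
        volume.real (A ∩ ball (x i) (4 * r i)) ≤ 2 * τ * (4 * r i) ^ n) →
      ∑ i ∈ s, r i ^ (n - 1) ≤ η := by
  obtain ⟨C, hC, hcut⟩ := exists_multi_cutoff n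
  obtain ⟨τ₀, hτ₀, hiso⟩ := iso n hn (C * 4 ^ n + 2) (by positivity)
  refine ⟨τ₀, hτ₀, fun A hA M hM τ hτ hττ η hη => ?_⟩
  set S : Set ℝ := {a | ∃ φ, IsTest univ φ ∧ a = ∫ x in A, vdiv φ x} with hS
  have hSne : S.Nonempty := by
    refine ⟨_, fun _ => 0, ⟨contDiff_const, HasCompactSupport.zero, subset_univ _, by simp⟩, rfl⟩
  have hSb : BddAbove S := ⟨M, by rintro _ ⟨φ, hφ, rfl⟩; exact hM φ hφ⟩
  have hsup : ∀ φ, IsTest univ φ → ∫ x in A, vdiv φ x ≤ sSup S := fun φ hφ =>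
    le_csSup hSb ⟨φ, hφ, rfl⟩
  obtain ⟨_, ⟨φ, hφ, rfl⟩, hlt⟩ := exists_lt_of_lt_csSup hSne
    (show sSup S - τ * η < sSup S by nlinarith [mul_pos hτ hη])
  obtain ⟨Cφ, hCφ0, hCφ⟩ := vdiv_bounded hφ.cd hφ.cs
  set ω : ℝ := volume.real (ball (0 : Eu n) 1) with hω
  have hωpos : 0 < ω := vol_ball_pos _ one_pos
  refine ⟨τ / (Cφ * (4 ^ n * ω)), by positivity, ?_⟩
  intro ι s x r hr hdisj hdens
  have hrn : ∀ i, r i ^ n = r i ^ (n - 1) * r i := fun i => by rw [← pow_succ]; congr 1; omega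
  obtain ⟨ψ, p1, p2, p3, p4, p5⟩ := hcut s x (fun i => 2 * r i) fun i hi => by
    have := (hr i hi).1; positivity
  have p1' : ContDiff ℝ 1 ψ := p1.of_le (by exact_mod_cast le_top)
  have hφi : ∀ i, ∃ φi, i ∈ s → (IsTest (ball (x i) (2 * r i)) φi ∧
      (C * 4 ^ n + 2) * τ * r i ^ (n - 1) ≤ ∫ y in A, vdiv φi y) := by
    intro i
    by_cases hi : i ∈ s
    · obtain ⟨φi, h⟩ := hiso τ hτ hττ A hA (x i) (r i) (hr i hi).1 (hdens i hi).1 (hdens i hi).2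
      exact ⟨φi, fun _ => h⟩
    · exact ⟨fun _ => 0, fun h => absurd h hi⟩
  choose Φ hΦ using hφi
  -- combined test
  have hcomb : (∫ y in A, vdiv (fun y => ψ y • φ y) y) + ∑ i ∈ s, ∫ y in A, vdiv (Φ i) y ≤ sSup S := by
    have := test_sum_le hsup (Finset.insertNone s)
      (fun o => o.elim ((⋃ i ∈ s, ball (x i) (2 * r i))ᶜ) (fun i => ball (x i) (2 * r i))) (by
        rintro (_ | i) hi (_ | j) hj hij
        · exact absurd rfl hij
        · have hj' : j ∈ s := by simpa using hj
          simp only [Function.onFun, Option.elim_none, Option.elim_some]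
          exact disjoint_compl_left_iff_subset.2 (subset_biUnion_of_mem (u := fun i => ball (x i) (2 * r i)) hj')
        · have hi' : i ∈ s := by simpa using hi
          simp only [Function.onFun, Option.elim_none, Option.elim_some]
          exact disjoint_compl_right_iff_subset.2 (subset_biUnion_of_mem (u := fun i => ball (x i) (2 * r i)) hi')
        · have hi' : i ∈ s := by simpa using hi
          have hj' : j ∈ s := by simpa using hj
          exact hdisj hi' hj' (fun h => hij (by rw [h])))
      (fun o => o.elim (fun y => ψ y • φ y) Φ) (by
        rintro (_ | i) hi
        · simp only [Option.elim_none]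
          refine ⟨p1'.smul hφ.cd, hφ.cs.smul_left (f := ψ), ?_, fun y => ?_⟩
          · refine closure_minimal ?_ (isOpen_biUnion fun i _ => isOpen_ball).isClosed_compl
            intro y hy hy'
            simp only [mem_iUnion] at hy'
            obtain ⟨i, hi, hyi⟩ := hy'
            exact hy (by simp [p3 i hi y (ball_subset_closedBall hyi)])
          · rw [norm_smul, Real.norm_eq_abs, abs_of_nonneg (p2 y).1]
            exact mul_le_one₀ (p2 y).2 (norm_nonneg _) (hφ.le y)
        · have hi' : i ∈ s := by simpa using hi
          exact (hΦ i hi').1)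
    simpa [Finset.sum_insertNone] using this
  have hlow : ∑ i ∈ s, (C * 4 ^ n + 2) * τ * r i ^ (n - 1) ≤ ∑ i ∈ s, ∫ y in A, vdiv (Φ i) y :=
    Finset.sum_le_sum fun i hi => (hΦ i hi).2
  -- gradient term
  have hg : |∫ y in A, fderiv ℝ ψ y (φ y)| ≤ ∑ i ∈ s, C * 4 ^ n * τ * r i ^ (n - 1) := by
    refine (abs_setIntegral_le_sum s (fun i => ball (x i) (2 * (2 * r i)))
      (fun _ _ => measurableSet_ball) (fun _ _ => measure_ball_lt_top.ne) (fun i => C / (2 * r i))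
      (fun y => ?_)).trans ?_
    · refine le_trans ?_ (p5 y)
      refine ((fderiv ℝ ψ y).le_opNorm _).trans ?_
      exact mul_le_of_le_one_right (norm_nonneg _) (hφ.le y)
    · refine Finset.sum_le_sum fun i hi => ?_
      have hri := (hr i hi).1
      rw [show 2 * (2 * r i) = 4 * r i by ring]
      calc _ ≤ C / (2 * r i) * (2 * τ * (4 * r i) ^ n) := by gcongr; exact (hdens i hi).2
        _ = _ := by rw [mul_pow, hrn]; field_simp
  have hcint : Continuous fun y => (1 - ψ y) * vdiv φ y :=
    (continuous_const.sub p1.continuous).mul (vdiv_continuous hφ.cd)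
  have hv : |∫ y in A, (1 - ψ y) * vdiv φ y| ≤ ∑ i ∈ s, τ * r i ^ (n - 1) := by
    refine (abs_setIntegral_le_sum s (fun i => ball (x i) (2 * (2 * r i)))
      (fun _ _ => measurableSet_ball) (fun _ _ => measure_ball_lt_top.ne) (fun i => Cφ)
      (fun y => ?_)).trans ?_
    · have h01 := p2 y
      by_cases hy : ∀ i ∈ s, y ∉ ball (x i) (2 * (2 * r i))
      · rw [p4 y hy]
        simp only [sub_self, zero_mul, abs_zero]
        exact Finset.sum_nonneg fun i _ => indicator_nonneg (fun _ _ => hCφ0.le) _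
      · push Not at hy
        obtain ⟨i, hi, hyi⟩ := hy
        refine le_trans ?_ (Finset.single_le_sum (f := fun i =>
          (ball (x i) (2 * (2 * r i))).indicator (fun _ => Cφ) y)
          (fun i _ => indicator_nonneg (fun _ _ => hCφ0.le) _) hi)
        simp only [indicator_of_mem hyi]
        rw [abs_mul, abs_of_nonneg (by linarith : 0 ≤ 1 - ψ y)]
        calc _ ≤ 1 * Cφ := mul_le_mul (by linarith) (hCφ y) (abs_nonneg _) zero_le_one
          _ = _ := one_mul _
    · refine Finset.sum_le_sum fun i hi => ?_
      have hri := hr i hi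
      have hri1 := hri.1
      rw [show 2 * (2 * r i) = 4 * r i by ring]
      calc Cφ * volume.real (A ∩ ball (x i) (4 * r i))
          ≤ Cφ * volume.real (ball (x i) (4 * r i)) := by
            gcongr
            · exact measure_ball_lt_top.ne
            · exact inter_subset_right
        _ = (Cφ * (4 ^ n * ω)) * r i * r i ^ (n - 1) := by
            rw [vol_ball_real _ (by positivity), mul_pow, hrn]; ring
        _ ≤ (Cφ * (4 ^ n * ω)) * (τ / (Cφ * (4 ^ n * ω))) * r i ^ (n - 1) := by
            gcongr; exact hri.2
        _ = _ := by field_simp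
  have hsplit : ∫ y in A, vdiv φ y
      = (∫ y in A, ψ y * vdiv φ y) + ∫ y in A, (1 - ψ y) * vdiv φ y := by
    rw [← integral_add]
    · refine integral_congr_ae (ae_of_all _ fun y => ?_)
      simp only; ring
    · exact ((p1.continuous.mul (vdiv_continuous hφ.cd)).integrable_of_hasCompactSupport
        ((vdiv_hcs hφ.cs).mul_left)).integrableOn
    · exact (hcint.integrable_of_hasCompactSupport ((vdiv_hcs hφ.cs).mul_left)).integrableOn
  rw [integral_cut p1' hφ.cd hφ.cs] at hsplit
  rw [← Finset.mul_sum] at hlow hg hv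
  have a1 := (abs_le.1 hg).1
  have a2 := (abs_le.1 hv).2
  set Q := ∑ i ∈ s, r i ^ (n - 1)
  have : τ * Q ≤ τ * η := by nlinarith
  exact le_of_mul_le_mul_left this hτ

/-- Coverings by countably many small balls with controlled `(n-1)`-content. -/
def Cov {n : ℕ} (s : Set (Eu n)) (δ : ℝ) (M : ℝ≥0∞) : Prop :=
  ∃ (ι : Type) (_ : Countable ι) (x : ι → Eu n) (r : ι → ℝ), (∀ i, 0 < r i ∧ r i ≤ δ) ∧
    s ⊆ ⋃ i, ball (x i) (r i) ∧ ∑' i, ENNReal.ofReal (r i ^ (n - 1)) ≤ M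

lemma Cov.mono {n : ℕ} {s t : Set (Eu n)} {δ δ' : ℝ} {M M' : ℝ≥0∞} (h : Cov t δ M) (hst : s ⊆ t)
    (hδ : δ ≤ δ') (hM : M ≤ M') : Cov s δ' M' := by
  obtain ⟨ι, hι, x, r, h1, h2, h3⟩ := h
  exact ⟨ι, hι, x, r, fun i => ⟨(h1 i).1, (h1 i).2.trans hδ⟩, hst.trans h2, h3.trans hM⟩

lemma Cov.iUnion {n : ℕ} {s : ℕ → Set (Eu n)} {δ : ℝ} {M : ℕ → ℝ≥0∞}
    (h : ∀ k, Cov (s k) δ (M k)) : Cov (⋃ k, s k) δ (∑' k, M k) := by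
  choose ι hι x r h1 h2 h3 using h
  refine ⟨Σ k, ι k, inferInstance, fun p => x p.1 p.2, fun p => r p.1 p.2, fun p => h1 _ _, ?_, ?_⟩
  · refine iUnion_subset fun k y hy => ?_
    obtain ⟨i, hi⟩ := mem_iUnion.1 (h2 k hy)
    exact mem_iUnion.2 ⟨⟨k, i⟩, hi⟩
  · rw [ENNReal.tsum_sigma (fun k i => ENNReal.ofReal (r k i ^ (n - 1)))]
    exact ENNReal.tsum_le_tsum h3

lemma Cov.union {n : ℕ} {s t : Set (Eu n)} {δ : ℝ} {M M' : ℝ≥0∞}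
    (h : Cov s δ M) (h' : Cov t δ M') : Cov (s ∪ t) δ (M + M') := by
  obtain ⟨ι, hι, x, r, h1, h2, h3⟩ := h
  obtain ⟨ι', hι', x', r', h1', h2', h3'⟩ := h'
  refine ⟨ι ⊕ ι', inferInstance, Sum.elim x x', Sum.elim r r', ?_, ?_, ?_⟩
  · rintro (i | i)
    · exact h1 i
    · exact h1' i
  · rintro y (hy | hy)
    · obtain ⟨i, hi⟩ := mem_iUnion.1 (h2 hy)
      exact mem_iUnion.2 ⟨Sum.inl i, hi⟩
    · obtain ⟨i, hi⟩ := mem_iUnion.1 (h2' hy)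
      exact mem_iUnion.2 ⟨Sum.inr i, hi⟩
  · rw [Summable.tsum_sum ENNReal.summable ENNReal.summable]
    exact add_le_add h3 h3'

lemma vitali_cov {n : ℕ} (S : Set (Eu n)) (δ η : ℝ) (Q : Eu n → ℝ → Prop)
    (h1 : ∀ x ∈ S, ∃ r, 0 < r ∧ r ≤ δ ∧ Q x r)
    (h2 : ∀ (s : Finset (Eu n)) (r : Eu n → ℝ), (∀ x ∈ s, 0 < r x ∧ r x ≤ δ) →
      ((s : Set (Eu n)).PairwiseDisjoint fun x => ball x (2 * r x)) → (∀ x ∈ s, Q x (r x)) →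
      ∑ x ∈ s, r x ^ (n - 1) ≤ η) :
    Cov S (12 * δ) (ENNReal.ofReal (12 ^ (n - 1) * η)) := by
  have : ∀ x, ∃ r, x ∈ S → (0 < r ∧ r ≤ δ ∧ Q x r) := fun x => by
    by_cases hx : x ∈ S
    · obtain ⟨r, hr⟩ := h1 x hx; exact ⟨r, fun _ => hr⟩
    · exact ⟨0, fun h => absurd h hx⟩
  choose r hr using this
  obtain ⟨u, huS, hdisj, hcov⟩ := Vitali.exists_disjoint_subfamily_covering_enlargement_closedBall
    S id (fun x => 2 * r x) (2 * δ) (fun x hx => by linarith [(hr x hx).2.1]) 5 (by norm_num)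
  have hucount : u.Countable := by
    refine hdisj.countable_of_nonempty_interior fun x hx => ?_
    have := (hr x (huS hx)).1
    exact ⟨x, ball_subset_interior_closedBall (mem_ball_self (by positivity))⟩
  have : Countable u := hucount.to_subtype
  refine ⟨u, inferInstance, fun x => x, fun x => 12 * r x, fun x => ?_, ?_, ?_⟩
  · have := hr x (huS x.2)
    exact ⟨by linarith, by linarith⟩
  · intro x hx
    obtain ⟨b, hb, hsub⟩ := hcov x hx
    have hrb := (hr b (huS hb)).1
    have hrx := (hr x hx).1
    refine mem_iUnion.2 ⟨⟨b, hb⟩, ?_⟩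
    have := hsub (mem_closedBall_self (by positivity))
    rw [mem_closedBall] at this
    rw [mem_ball]
    simp only [id] at this ⊢
    linarith
  · rw [ENNReal.tsum_eq_iSup_sum]
    refine iSup_le fun s => ?_
    rw [← ENNReal.ofReal_sum_of_nonneg]
    swap
    · intro x _
      have := (hr x (huS x.2)).1
      positivity
    refine ENNReal.ofReal_le_ofReal ?_
    simp_rw [mul_pow]
    rw [← Finset.mul_sum]
    refine mul_le_mul_of_nonneg_left ?_ (by positivity)
    have hmem : ∀ x ∈ s.map (Function.Embedding.subtype _), x ∈ u := by
      intro x hx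
      obtain ⟨y, _, rfl⟩ := Finset.mem_map.1 hx
      exact y.2
    have := h2 (s.map (Function.Embedding.subtype _)) r
      (fun x hx => ⟨(hr x (huS (hmem x hx))).1, (hr x (huS (hmem x hx))).2.1⟩) (by
        intro x hx y hy hxy
        exact (hdisj (hmem x hx) (hmem y hy) hxy).mono ball_subset_closedBall ball_subset_closedBall)
      (fun x hx => (hr x (huS (hmem x hx))).2.2)
    simpa using this

lemma hausdorff_le_of_cov {n : ℕ} (hn : 2 ≤ n) {S : Set (Eu n)} {M : ℝ≥0∞}
    (h : ∀ δ : ℝ, 0 < δ → Cov S δ M) : μH[(n : ℝ) - 1] S ≤ 2 ^ (n - 1) * M := by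
  choose ι hι x r h1 h2 h3 using fun k : ℕ => h (1 / ((k : ℝ) + 1)) (by positivity)
  have hd : (n : ℝ) - 1 = ((n - 1 : ℕ) : ℝ) := by
    rw [Nat.cast_sub (by omega)]; simp
  have hdiam : ∀ k i, ediam (ball (x k i) (r k i)) ≤ 2 * ENNReal.ofReal (r k i) := fun k i => by
    rw [← eball_ofReal]
    exact ediam_eball_le
  have := Measure.hausdorffMeasure_le_liminf_tsum ((n : ℝ) - 1) S (l := atTop)
    (fun k : ℕ => 2 * ENNReal.ofReal (1 / ((k : ℝ) + 1))) (by
      have : Tendsto (fun k : ℕ => ENNReal.ofReal (1 / ((k : ℝ) + 1))) atTop (𝓝 (ENNReal.ofReal 0)) :=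
        (ENNReal.continuous_ofReal.tendsto _).comp tendsto_one_div_add_atTop_nhds_zero_nat
      simpa using ENNReal.Tendsto.const_mul (a := 2) this (Or.inr (by simp)))
    (fun k i => ball (x k i) (r k i)) (Eventually.of_forall fun k i => (hdiam k i).trans (by
      gcongr; exact (h1 k i).2)) (Eventually.of_forall h2)
  refine this.trans ?_
  refine (liminf_le_liminf (v := fun _ => 2 ^ (n - 1) * M) (Eventually.of_forall fun k => ?_)).trans_eq (liminf_const _)
  refine le_trans ?_ (mul_le_mul_right (h3 k) _)
  rw [← ENNReal.tsum_mul_left]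
  refine ENNReal.tsum_le_tsum fun i => ?_
  rw [hd, ENNReal.rpow_natCast, ENNReal.ofReal_pow (h1 k i).1.le, ← mul_pow]
  gcongr
  exact hdiam k i

lemma cov_of_hausdorff {n : ℕ} (hn : 2 ≤ n) {S : Set (Eu n)}
    (h : μH[(n : ℝ) - 1] S < ⊤) : ∃ M : ℝ≥0∞, M < ⊤ ∧ ∀ δ : ℝ, 0 < δ → Cov S δ M := by
  classical
  have hd : (n : ℝ) - 1 = ((n - 1 : ℕ) : ℝ) := by
    rw [Nat.cast_sub (by omega)]; simp
  refine ⟨2 ^ (n - 1) * (μH[(n : ℝ) - 1] S + 1) + 2, ?_, fun δ hδ => ?_⟩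
  · refine ENNReal.add_lt_top.2 ⟨ENNReal.mul_lt_top (by finiteness) (ENNReal.add_lt_top.2 ⟨h, by simp⟩), by simp⟩
  rw [Measure.hausdorffMeasure_apply] at h ⊢
  set H := ⨆ (r : ℝ≥0∞) (_ : 0 < r),
        ⨅ (t : ℕ → Set (Eu n)) (_ : S ⊆ ⋃ n, t n) (_ : ∀ n, ediam (t n) ≤ r),
          ∑' k, ⨆ _ : (t k).Nonempty, ediam (t k) ^ ((n : ℝ) - 1)
  have hlt : ⨅ (t : ℕ → Set (Eu n)) (_ : S ⊆ ⋃ n, t n) (_ : ∀ n, ediam (t n) ≤ ENNReal.ofReal (δ / 2)),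
          ∑' k, ⨆ _ : (t k).Nonempty, ediam (t k) ^ ((n : ℝ) - 1) < H + 1 := by
    refine lt_of_le_of_lt ?_ (ENNReal.lt_add_right h.ne one_ne_zero)
    exact le_iSup₂_of_le (ENNReal.ofReal (δ / 2)) (by simpa using hδ) le_rfl
  simp only [iInf_lt_iff] at hlt
  obtain ⟨t, ht1, ht2, ht3⟩ := hlt
  -- radii
  let ρ : ℕ → ℝ := fun k => if diam (t k) = 0 then min δ ((1 / 2) ^ k) else 2 * diam (t k)
  have hfin : ∀ k, ediam (t k) ≠ ⊤ := fun k => ((ht2 k).trans_lt ENNReal.ofReal_lt_top).ne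
  have hdiam : ∀ k, diam (t k) ≤ δ / 2 := fun k => by
    rw [diam]
    exact ENNReal.toReal_le_of_le_ofReal (by positivity) (ht2 k)
  let c : ℕ → Eu n := fun k => if hk : (t k).Nonempty then hk.some else 0
  have hρ : ∀ k, 0 < ρ k ∧ ρ k ≤ δ := fun k => by
    simp only [ρ]
    split_ifs with hk
    · exact ⟨lt_min hδ (by positivity), min_le_left _ _⟩
    · have := lt_of_le_of_ne diam_nonneg (Ne.symm hk)
      exact ⟨by positivity, by linarith [hdiam k]⟩
  have hsub : ∀ k, t k ⊆ ball (c k) (ρ k) := fun k y hy => by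
    have hne : (t k).Nonempty := ⟨y, hy⟩
    have h1 : dist y (c k) ≤ diam (t k) := by
      simp only [c, dif_pos hne]
      exact dist_le_diam_of_mem' (hfin k) hy hne.some_mem
    rw [mem_ball]
    refine h1.trans_lt ?_
    by_cases hk : diam (t k) = 0
    · rw [hk]; exact (hρ k).1
    · have := lt_of_le_of_ne diam_nonneg (Ne.symm hk)
      simp only [ρ, if_neg hk]; linarith
  refine ⟨ℕ, inferInstance, c, ρ, hρ, ht1.trans (iUnion_mono hsub), ?_⟩
  have hb : ∀ k, ENNReal.ofReal (ρ k ^ (n - 1)) ≤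
      2 ^ (n - 1) * (⨆ _ : (t k).Nonempty, ediam (t k) ^ ((n : ℝ) - 1)) + (2⁻¹ : ℝ≥0∞) ^ k := fun k => by
    by_cases hk : diam (t k) = 0
    · refine le_trans ?_ le_add_self
      have : ρ k ≤ (1 / 2) ^ k := by simp only [ρ, if_pos hk]; exact min_le_right _ _
      have h1 : ρ k ^ (n - 1) ≤ (1 / 2) ^ k := by
        calc ρ k ^ (n - 1) ≤ ρ k ^ 1 := by
              refine pow_le_pow_of_le_one (hρ k).1.le (this.trans ?_) (by omega)
              exact pow_le_one₀ (by norm_num) (by norm_num)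
          _ ≤ _ := by simpa using this
      refine (ENNReal.ofReal_le_ofReal h1).trans_eq ?_
      rw [ENNReal.ofReal_pow (by norm_num)]
      congr 1
      rw [one_div, ENNReal.ofReal_inv_of_pos (by norm_num)]; simp
    · refine le_trans ?_ le_self_add
      have hne : (t k).Nonempty := by
        by_contra hne
        rw [not_nonempty_iff_eq_empty] at hne
        exact hk (by rw [hne, diam_empty])
      rw [ciSup_pos hne, hd, ENNReal.rpow_natCast, ENNReal.ofReal_pow (hρ k).1.le, ← mul_pow]
      gcongr
      simp only [ρ, if_neg hk]
      rw [ENNReal.ofReal_mul (by norm_num), diam, ENNReal.ofReal_toReal (hfin k)]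
      simp
  refine (ENNReal.tsum_le_tsum hb).trans ?_
  rw [ENNReal.tsum_add, ENNReal.tsum_mul_left, ENNReal.tsum_geometric_two]
  gcongr

lemma crossing {n : ℕ} {A : Set (Eu n)} {x : Eu n} {δ τ : ℝ} (hδ : 0 < δ) (hτ : 0 < τ)
    (h0 : volume.real (A ∩ ball x δ) < τ * δ ^ n)
    (h1 : ∃ i : ℕ, τ * (δ / 4 ^ i) ^ n ≤ volume.real (A ∩ ball x (δ / 4 ^ i))) :
    ∃ r, 0 < r ∧ r ≤ δ ∧ (τ * r ^ n ≤ volume.real (A ∩ ball x r) ∧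
      volume.real (A ∩ ball x (4 * r)) ≤ 2 * τ * (4 * r) ^ n) := by
  classical
  have hs := Nat.find_spec h1
  set i := Nat.find h1 with hi
  have hi0 : i ≠ 0 := by
    intro h
    rw [h] at hs
    simp only [pow_zero, div_one] at hs
    linarith
  obtain ⟨j, hj⟩ := Nat.exists_eq_succ_of_ne_zero hi0
  have hm := Nat.find_min h1 (m := j) (by omega)
  refine ⟨δ / 4 ^ i, by positivity, div_le_self hδ.le (one_le_pow₀ (by norm_num)), hs, ?_⟩
  have : 4 * (δ / 4 ^ i) = δ / 4 ^ j := by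
    rw [hj, pow_succ]; field_simp
  rw [this]
  push Not at hm
  have hp : 0 ≤ τ * (δ / 4 ^ j) ^ n := by positivity
  linarith

lemma smooth_density {n : ℕ} {f : Eu n → ℝ} (hf : ContDiff ℝ (⊤ : ℕ∞) f) {x : Eu n} (hx : 0 ≤ f x)
    (hd : f x = 0 → fderiv ℝ f x ≠ 0) : ∃ r₀ > 0, ∀ r, 0 < r → r ≤ r₀ →
      (1 / 8) ^ n * volume.real (ball (0 : Eu n) 1) * r ^ n ≤
        volume.real ({y | 0 ≤ f y} ∩ ball x r) := by
  have key : ∀ r, 0 < r → (∃ y, ball y (r / 8) ⊆ {y | 0 ≤ f y} ∩ ball x r) →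
      (1 / 8) ^ n * volume.real (ball (0 : Eu n) 1) * r ^ n ≤
        volume.real ({y | 0 ≤ f y} ∩ ball x r) := by
    rintro r hr ⟨y, hy⟩
    calc _ = volume.real (ball y (r / 8)) := by
          rw [vol_ball_real y (by positivity : 0 < r / 8), div_pow, div_pow]; ring
      _ ≤ _ := measureReal_mono hy
        ((measure_mono inter_subset_right).trans_lt measure_ball_lt_top).ne
  rcases hx.eq_or_lt with h0 | h0
  · have hne := hd h0.symm
    set L := fderiv ℝ f x with hL
    set g := (InnerProductSpace.toDual ℝ (Eu n)).symm L with hg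
    have hLg : ∀ v, L v = inner ℝ g v := fun v => by
      rw [hg, InnerProductSpace.toDual_symm_apply]
    have hgn : 0 < ‖g‖ := by
      rw [norm_pos_iff]; intro h
      exact hne (by simpa [hg] using h)
    have hdiff : HasFDerivAt f L x := (hf.differentiable (by simp) x).hasFDerivAt
    have := hdiff.isLittleO.def (show 0 < ‖g‖ / 8 by positivity)
    obtain ⟨r₀, hr₀, hball⟩ := Metric.eventually_nhds_iff_ball.1 this
    refine ⟨r₀, hr₀, fun r hr hrr => key r hr ⟨x + (r / 2 / ‖g‖) • g, fun y hy => ?_⟩⟩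
    set v := y - (x + (r / 2 / ‖g‖) • g) with hv
    have hvn : ‖v‖ < r / 8 := by rw [hv, ← dist_eq_norm]; exact hy
    have hyx : y - x = (r / 2 / ‖g‖) • g + v := by rw [hv]; abel
    have hnorm : ‖y - x‖ < r := by
      rw [hyx]
      refine (norm_add_le _ _).trans_lt ?_
      rw [norm_smul, Real.norm_eq_abs, abs_of_nonneg (by positivity), div_mul_cancel₀ _ hgn.ne']
      linarith
    have hyb : y ∈ ball x r := by rw [mem_ball, dist_eq_norm]; exact hnorm
    refine ⟨?_, hyb⟩
    have h1 := hball y (ball_subset_ball hrr hyb)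
    rw [← h0, sub_zero, Real.norm_eq_abs] at h1
    have h2 := (abs_le.1 h1).1
    have h3 : L (y - x) = r / 2 * ‖g‖ + inner ℝ g v := by
      rw [hLg, hyx, inner_add_right, inner_smul_right, real_inner_self_eq_norm_sq]
      field_simp
    have h4 := (abs_le.1 (abs_real_inner_le_norm g v)).1
    simp only [mem_ofPred_eq]
    nlinarith [mul_lt_mul_of_pos_left hvn hgn, mul_lt_mul_of_pos_left hnorm hgn, mul_pos hr hgn]
  · obtain ⟨r₀, hr₀, hball⟩ := Metric.eventually_nhds_iff_ball.1
      (hf.continuous.continuousAt.eventually_const_lt h0)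
    exact ⟨r₀, hr₀, fun r hr hrr => key r hr ⟨x, fun y hy =>
      ⟨(hball y (ball_subset_ball (by linarith) hy)).le, ball_subset_ball (by linarith) hy⟩⟩⟩

lemma dens_iff {n : ℕ} {Ω : Set (Eu n)} (hm : MeasurableSet Ω) (x : Eu n) :
    x ∈ densityPts Ω 1 ↔
      Tendsto (fun r : ℝ => volume.real (Ωᶜ ∩ ball x r) / r ^ n) (𝓝[>] 0) (𝓝 0) := by
  set ω := volume.real (ball (0 : Eu n) 1) with hω
  have hωpos : 0 < ω := vol_ball_pos _ one_pos
  have h1 : ∀ r : ℝ, 0 < r → volume (Ω ∩ ball x r) / volume (ball x r) ≠ ⊤ := fun r hr =>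
    (ENNReal.div_lt_top ((measure_mono inter_subset_right).trans_lt measure_ball_lt_top).ne
      (measure_ball_pos _ _ hr).ne').ne
  have h2 : ∀ r : ℝ, 0 < r → volume.real (Ωᶜ ∩ ball x r) / r ^ n
      = ω * (1 - (volume (Ω ∩ ball x r) / volume (ball x r)).toReal) := fun r hr => by
    have e : volume.real (ball x r) = volume.real (Ω ∩ ball x r) + volume.real (Ωᶜ ∩ ball x r) := by
      have := measureReal_inter_add_sdiff (μ := volume) (s := ball x r) (t := Ω) hm
        measure_ball_lt_top.ne
      rw [← this, inter_comm, sdiff_eq, inter_comm (ball x r) Ωᶜ]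
    rw [ENNReal.toReal_div]
    change _ = ω * (1 - volume.real _ / volume.real _)
    have e2 := vol_ball_real x hr
    have : volume.real (Ωᶜ ∩ ball x r) = r ^ n * ω - volume.real (Ω ∩ ball x r) := by linarith
    rw [e2, ← hω, this]
    field_simp
  have h3 : (fun r : ℝ => volume.real (Ωᶜ ∩ ball x r) / r ^ n) =ᶠ[𝓝[>] 0]
      fun r => ω * (1 - (volume (Ω ∩ ball x r) / volume (ball x r)).toReal) := by
    filter_upwards [self_mem_nhdsWithin] with r hr using h2 r hr
  rw [tendsto_congr' h3]
  have h4 : x ∈ densityPts Ω 1 ↔ Tendsto (fun r : ℝ =>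
      (volume (Ω ∩ ball x r) / volume (ball x r)).toReal) (𝓝[>] 0) (𝓝 1) := by
    constructor
    · intro h
      have h' := (ENNReal.tendsto_toReal ENNReal.one_ne_top).comp h
      rw [ENNReal.toReal_one] at h'
      exact h'
    · intro h
      have h' := ENNReal.tendsto_ofReal h
      rw [ENNReal.ofReal_one] at h'
      refine Tendsto.congr' ?_ h'
      filter_upwards [self_mem_nhdsWithin] with r hr using ENNReal.ofReal_toReal (h1 r hr)
  rw [h4]
  constructor
  · intro h
    simpa using (h.const_sub 1).const_mul ω
  · intro h
    have := ((h.const_mul ω⁻¹).const_sub 1)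
    simp only [mul_zero, sub_zero] at this
    refine this.congr fun r => ?_
    field_simp; ring

lemma dir_back (n : ℕ) (hn : 2 ≤ n) (Ω : Set (Eu n)) (hm : MeasurableSet Ω) (E : ℕ → Set (Eu n))
    (hE1 : ∀ k, IsSmoothSet (E k)) (hE2 : ∀ k, CpctContained (E k) Ω) (hE3 : TendstoL1 E Ω)
    (hE4 : (⨆ k, perimeter (E k)) < ⊤) :
    μH[(n : ℝ) - 1] (frontier Ω ∩ densityPts Ω 1) < ⊤ := by
  obtain ⟨τ₀, hτ₀, hiso⟩ := iso n hn 1 one_pos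
  set ω := volume.real (ball (0 : Eu n) 1) with hω
  have hωpos : 0 < ω := vol_ball_pos _ one_pos
  set τ := min τ₀ ((1 / 8) ^ n * ω) with hτdef
  have hτ : 0 < τ := lt_min hτ₀ (by positivity)
  set M := (⨆ k, perimeter (E k)).toReal with hMdef
  have hM0 : 0 ≤ M := ENNReal.toReal_nonneg
  have hM : ∀ k φ, IsTest univ φ → ∫ x in E k, vdiv φ x ≤ M := fun k => by
    rw [← perimeter_le_iff hM0, hMdef, ENNReal.ofReal_toReal hE4.ne]
    exact le_iSup (fun k => perimeter (E k)) k
  let S : ℕ → Set (Eu n) := fun m => {x ∈ frontier Ω ∩ densityPts Ω 1 |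
    ∀ r : ℝ, 0 < r → r ≤ 1 / ((m : ℝ) + 1) → volume.real (Ωᶜ ∩ ball x r) ≤ τ / 4 * r ^ n}
  have hSmono : Monotone S := fun a b hab x hx => ⟨hx.1, fun r hr hrb => hx.2 r hr (hrb.trans (by
    gcongr))⟩
  have hSU : frontier Ω ∩ densityPts Ω 1 = ⋃ m, S m := by
    refine Subset.antisymm (fun x hx => ?_) (iUnion_subset fun m x hx => hx.1)
    have h := (dens_iff hm x).1 hx.2
    have h2 := h.eventually_lt_const (show (0 : ℝ) < τ / 4 by positivity)
    obtain ⟨ε, hε, hball⟩ := mem_nhdsGT_iff_exists_Ioc_subset.1 h2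
    obtain ⟨m, hmm⟩ := exists_nat_one_div_lt (show (0 : ℝ) < ε from hε)
    refine mem_iUnion.2 ⟨m, hx, fun r hr hrm => ?_⟩
    have := hball ⟨hr, hrm.trans hmm.le⟩
    simp only [mem_ofPred_eq] at this
    rw [div_lt_iff₀ (by positivity)] at this
    exact this.le
  have hcov : ∀ m, ∀ δ₀ : ℝ, 0 < δ₀ → Cov (S m) δ₀ (ENNReal.ofReal (12 ^ (n - 1) * (M / τ))) := by
    intro m δ₀ hδ₀
    set δ := min (δ₀ / 12) (1 / ((m : ℝ) + 1)) with hδdef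
    have hδ : 0 < δ := lt_min (by positivity) (by positivity)
    have hev := hE3.eventually_lt_const (show (0 : ℝ≥0∞) < ENNReal.ofReal (τ / 2 * δ ^ n) by
      rw [ENNReal.ofReal_pos]; positivity)
    obtain ⟨k, hk⟩ := hev.exists
    obtain ⟨hEo, hEb, f, hf1, hf2, hf3, hf4⟩ := hE1 k
    have hA : MeasurableSet (E k)ᶜ := hEo.measurableSet.compl
    have hAf : (E k)ᶜ = {y | 0 ≤ f y} := by
      rw [hf2]; ext y; simp
    have hlt : volume (Ω \ E k) < ENNReal.ofReal (τ / 2 * δ ^ n) :=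
      (measure_mono subset_union_right).trans_lt hk
    have hltr : volume.real (Ω \ E k) ≤ τ / 2 * δ ^ n :=
      ENNReal.toReal_le_of_le_ofReal (by positivity) hlt.le
    refine (vitali_cov (S m) δ (M / τ) (fun x r => τ * r ^ n ≤ volume.real ((E k)ᶜ ∩ ball x r) ∧
      volume.real ((E k)ᶜ ∩ ball x (4 * r)) ≤ 2 * τ * (4 * r) ^ n) ?_ ?_).mono subset_rfl
      (by linarith [min_le_left (δ₀ / 12) (1 / ((m : ℝ) + 1))]) le_rfl
    · intro x hx
      have hxE : x ∉ E k := fun h => by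
        have : x ∈ interior Ω := interior_maximal (subset_closure.trans (hE2 k).2) hEo h
        exact hx.1.1.2 this
      refine crossing hδ hτ ?_ ?_
      · have hsub : (E k)ᶜ ∩ ball x δ ⊆ (Ωᶜ ∩ ball x δ) ∪ (Ω \ E k) := by
          intro y hy
          by_cases hyΩ : y ∈ Ω
          · exact Or.inr ⟨hyΩ, hy.1⟩
          · exact Or.inl ⟨hyΩ, hy.2⟩
        have h1 : volume.real ((E k)ᶜ ∩ ball x δ) ≤
            volume.real (Ωᶜ ∩ ball x δ) + volume.real (Ω \ E k) :=
          (measureReal_mono hsub (measure_union_lt_top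
            ((measure_mono inter_subset_right).trans_lt measure_ball_lt_top)
            (hlt.trans ENNReal.ofReal_lt_top)).ne).trans (measureReal_union_le _ _)
        have h2 := hx.2 δ hδ (min_le_right _ _)
        have h3 : 0 < τ * δ ^ n := by positivity
        linarith
      · obtain ⟨r₀, hr₀, hr⟩ := smooth_density hf1 (x := x) (by
          rw [hf2] at hxE; simpa using hxE) (fun h => hf4 x (by rw [hf3]; exact h))
        obtain ⟨i, hi⟩ := exists_pow_lt_of_lt_one (show 0 < r₀ / δ by positivity)
          (show (1 / 4 : ℝ) < 1 by norm_num)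
        have hle : δ / 4 ^ i ≤ r₀ := by
          rw [lt_div_iff₀ hδ, one_div, inv_pow] at hi
          rw [div_eq_inv_mul]; exact hi.le
        refine ⟨i, le_trans ?_ (hAf ▸ hr _ (by positivity) hle)⟩
        gcongr
        exact min_le_right _ _
    · intro s r hr hdisj hQ
      have hφi : ∀ x, ∃ φi, x ∈ s → (IsTest (ball x (2 * r x)) φi ∧
          1 * τ * r x ^ (n - 1) ≤ ∫ y in (E k)ᶜ, vdiv φi y) := by
        intro x
        by_cases hi : x ∈ s
        · obtain ⟨φi, h⟩ := hiso τ hτ (min_le_left _ _) _ hA x (r x) (hr x hi).1 (hQ x hi).1 (hQ x hi).2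
          exact ⟨φi, fun _ => h⟩
        · exact ⟨fun _ => 0, fun h => absurd h hi⟩
      choose Φ hΦ using hφi
      have := test_sum_le (hM k) s (fun x => ball x (2 * r x)) hdisj (fun x y => -Φ x y)
        (fun x hx => (hΦ x hx).1.neg)
      have h2 : ∑ x ∈ s, τ * r x ^ (n - 1) ≤ ∑ x ∈ s, ∫ y in E k, vdiv (fun y => -Φ x y) y := by
        refine Finset.sum_le_sum fun x hx => ?_
        have h3 := (hΦ x hx).2
        rw [integral_compl_vdiv hEo.measurableSet (hΦ x hx).1.cd (hΦ x hx).1.cs] at h3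
        simp_rw [vdiv_neg]
        rw [integral_neg]
        linarith
      rw [le_div_iff₀ hτ, mul_comm, Finset.mul_sum]
      exact h2.trans this
  have hmeas : ∀ m, μH[(n : ℝ) - 1] (S m) ≤ 2 ^ (n - 1) * ENNReal.ofReal (12 ^ (n - 1) * (M / τ)) :=
    fun m => hausdorff_le_of_cov hn (hcov m)
  rw [hSU, hSmono.measure_iUnion]
  refine (iSup_le hmeas).trans_lt (ENNReal.mul_lt_top (by finiteness) ENNReal.ofReal_lt_top)

lemma density_of_geom {n : ℕ} {Ω : Set (Eu n)} (hm : MeasurableSet Ω) {x : Eu n} {δ τ₀ : ℝ}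
    (hδ : 0 < δ) (hτ₀ : 0 < τ₀)
    (h : ∀ j : ℕ, ∀ᶠ i : ℕ in atTop,
      volume.real (Ωᶜ ∩ ball x (δ / 4 ^ i)) < τ₀ / 2 ^ j * (δ / 4 ^ i) ^ n) :
    x ∈ densityPts Ω 1 := by
  rw [dens_iff hm]
  refine tendsto_order.2 ⟨fun a ha => ?_, fun ε hε => ?_⟩
  · filter_upwards [self_mem_nhdsWithin] with r hr
    have : 0 < r := hr
    exact ha.trans_le (by positivity)
  obtain ⟨j, hj⟩ := exists_pow_lt_of_lt_one (show 0 < ε / (4 ^ n * τ₀) by positivity)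
    (show (1 / 2 : ℝ) < 1 by norm_num)
  obtain ⟨N, hN⟩ := eventually_atTop.1 (h j)
  have hpos : 0 < δ / 4 ^ N := by positivity
  filter_upwards [Ioc_mem_nhdsGT hpos] with r hr
  have hr0 : 0 < r := hr.1
  obtain ⟨m, hm1, hm2⟩ := exists_nat_pow_near_of_lt_one (x := r / (δ / 4 ^ N)) (y := 1 / 4)
    (by positivity) (div_le_one_of_le₀ hr.2 hpos.le) (by norm_num) (by norm_num)
  have hi := hN (N + m) (by omega)
  have e1 : r ≤ δ / 4 ^ (N + m) := by
    rw [div_le_iff₀ hpos] at hm2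
    refine hm2.trans_eq ?_
    rw [div_pow, pow_add]; field_simp; simp
  have e2 : δ / 4 ^ (N + m) < 4 * r := by
    rw [lt_div_iff₀ hpos] at hm1
    have : δ / 4 ^ (N + m) = 4 * ((1 / 4) ^ (m + 1) * (δ / 4 ^ N)) := by
      rw [div_pow, pow_add, pow_succ]; field_simp; simp [pow_succ]
    rw [this]; linarith
  rw [div_lt_iff₀ (by positivity)]
  have hc : τ₀ / 2 ^ j * 4 ^ n < ε := by
    rw [lt_div_iff₀ (by positivity), div_pow, one_pow] at hj
    calc _ = 1 / 2 ^ j * (4 ^ n * τ₀) := by ring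
      _ < ε := hj
  calc volume.real (Ωᶜ ∩ ball x r) ≤ volume.real (Ωᶜ ∩ ball x (δ / 4 ^ (N + m))) :=
        measureReal_mono (inter_subset_inter_right _ (ball_subset_ball e1))
          ((measure_mono inter_subset_right).trans_lt measure_ball_lt_top).ne
    _ ≤ τ₀ / 2 ^ j * (δ / 4 ^ (N + m)) ^ n := hi.le
    _ ≤ τ₀ / 2 ^ j * (4 * r) ^ n := by gcongr
    _ = (τ₀ / 2 ^ j * 4 ^ n) * r ^ n := by rw [mul_pow]; ring
    _ < ε * r ^ n := by gcongr

lemma densityPts_subset_closure {n : ℕ} {Ω : Set (Eu n)} : densityPts Ω 1 ⊆ closure Ω := by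
  intro x hx
  by_contra hxc
  have : (closure Ω)ᶜ ∈ 𝓝 x := isClosed_closure.isOpen_compl.mem_nhds hxc
  obtain ⟨ε, hε, hb⟩ := Metric.mem_nhds_iff.1 this
  have h0 : (fun r : ℝ => volume (Ω ∩ ball x r) / volume (ball x r)) =ᶠ[𝓝[>] 0] fun _ => 0 := by
    filter_upwards [Ioc_mem_nhdsGT hε] with r hr
    have : Ω ∩ ball x r = ∅ := by
      refine eq_empty_of_forall_notMem fun y hy => ?_
      exact hb (ball_subset_ball hr.2 hy.2) (subset_closure hy.1)
    rw [this]; simp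
  have h1 : Tendsto (fun r : ℝ => volume (Ω ∩ ball x r) / volume (ball x r)) (𝓝[>] 0) (𝓝 1) := hx
  have h2 := tendsto_nhds_unique (h1.congr' h0) tendsto_const_nhds
  exact one_ne_zero h2

lemma big_cov (n : ℕ) (hn : 2 ≤ n) (Ω : Set (Eu n)) (hm : MeasurableSet Ω) (M : ℝ)
    (hM : ∀ φ, IsTest univ φ → ∫ x in Ωᶜ, vdiv φ x ≤ M)
    (hH : μH[(n : ℝ) - 1] (frontier Ω ∩ densityPts Ω 1) < ⊤) :
    ∃ τ₀ : ℝ, 0 < τ₀ ∧ ∃ M' : ℝ≥0∞, M' < ⊤ ∧ ∀ δ₀ : ℝ, 0 < δ₀ → ∃ δ, 0 < δ ∧ δ ≤ δ₀ ∧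
      Cov {x ∈ (interior Ω)ᶜ | volume.real (Ωᶜ ∩ ball x δ) < τ₀ * δ ^ n} (12 * δ) M' := by
  classical
  obtain ⟨τ₀, hτ₀, hkey⟩ := key_sum n hn
  obtain ⟨MS, hMS, hcovS⟩ := cov_of_hausdorff hn hH
  have hsum : Summable fun j : ℕ => (12 : ℝ) ^ (n - 1) * (1 / 2) ^ j :=
    (summable_geometric_of_lt_one (by norm_num) (by norm_num)).mul_left _
  refine ⟨τ₀, hτ₀, (∑' j : ℕ, ENNReal.ofReal (12 ^ (n - 1) * (1 / 2) ^ j)) + MS,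
    ENNReal.add_lt_top.2 ⟨hsum.tsum_ofReal_lt_top, hMS⟩, fun δ₀ hδ₀ => ?_⟩
  choose D hD0 hD using fun j : ℕ => hkey Ωᶜ hm.compl M hM (τ₀ / 2 ^ j) (by positivity)
    (div_le_self hτ₀.le (one_le_pow₀ (by norm_num))) ((1 / 2) ^ j) (by positivity)
  set δ := min δ₀ (D 0) with hδdef
  have hδ : 0 < δ := lt_min hδ₀ (hD0 0)
  refine ⟨δ, hδ, min_le_left _ _, ?_⟩
  let Q : ℕ → Eu n → ℝ → Prop := fun j x r =>
    τ₀ / 2 ^ j * r ^ n ≤ volume.real (Ωᶜ ∩ ball x r) ∧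
        volume.real (Ωᶜ ∩ ball x (4 * r)) ≤ 2 * (τ₀ / 2 ^ j) * (4 * r) ^ n
  let T : ℕ → Set (Eu n) := fun j => {x | ∃ r, 0 < r ∧ r ≤ min δ (D j) ∧ Q j x r}
  have hT : ∀ j, Cov (T j) (12 * δ) (ENNReal.ofReal (12 ^ (n - 1) * (1 / 2) ^ j)) := fun j => by
    refine (vitali_cov (T j) (min δ (D j)) ((1 / 2) ^ j) (Q j) (fun x hx => hx) ?_).mono subset_rfl
      (by linarith [min_le_left δ (D j)]) le_rfl
    intro s r hr hdisj hQ
    exact hD j s id r (fun i hi => ⟨(hr i hi).1, (hr i hi).2.trans (min_le_right _ _)⟩) hdisj hQ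
  refine ((Cov.iUnion hT).union (hcovS (12 * δ) (by positivity))).mono ?_ le_rfl le_rfl
  rintro x ⟨hxU, hx0⟩
  by_cases hc : ∃ i : ℕ, τ₀ * (δ / 4 ^ i) ^ n ≤ volume.real (Ωᶜ ∩ ball x (δ / 4 ^ i))
  · obtain ⟨r, h1, h2, h3⟩ := crossing hδ hτ₀ hx0 hc
    refine Or.inl (mem_iUnion.2 ⟨0, r, h1, h2.trans (le_min le_rfl (min_le_right _ _)), ?_⟩)
    simpa [Q] using h3
  push Not at hc
  by_cases hall : ∀ j : ℕ, ∀ᶠ i : ℕ in atTop,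
      volume.real (Ωᶜ ∩ ball x (δ / 4 ^ i)) < τ₀ / 2 ^ j * (δ / 4 ^ i) ^ n
  · have hd := density_of_geom hm hδ hτ₀ hall
    exact Or.inr ⟨⟨densityPts_subset_closure hd, hxU⟩, hd⟩
  rw [not_forall] at hall
  have hs := Nat.find_spec hall
  set j := Nat.find hall with hj
  have hj0 : j ≠ 0 := by
    intro h
    rw [h] at hs
    exact hs (Eventually.of_forall fun i => by simpa using hc i)
  obtain ⟨k, hk⟩ := Nat.exists_eq_succ_of_ne_zero hj0
  have hmin := Nat.find_min hall (m := k) (by omega)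
  rw [not_not] at hmin
  obtain ⟨N, hN⟩ := eventually_atTop.1 hmin
  obtain ⟨N', hN'⟩ := exists_pow_lt_of_lt_one (show 0 < D j / δ from div_pos (hD0 j) hδ)
    (show (1 / 4 : ℝ) < 1 by norm_num)
  obtain ⟨i, hi1, hi2⟩ := (frequently_atTop.1 (not_eventually.1 hs)) (N + N' + 1)
  rw [not_lt] at hi2
  obtain ⟨i', rfl⟩ : ∃ i', i = i' + 1 := ⟨i - 1, by omega⟩
  refine Or.inl (mem_iUnion.2 ⟨j, δ / 4 ^ (i' + 1), by positivity,
    le_min (div_le_self hδ.le (one_le_pow₀ (by norm_num))) ?_, hi2, ?_⟩)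
  · rw [lt_div_iff₀ hδ, one_div, inv_pow] at hN'
    calc δ / 4 ^ (i' + 1) ≤ δ / 4 ^ N' := by
          gcongr
          · norm_num
          · omega
      _ = (4 ^ N')⁻¹ * δ := by rw [div_eq_inv_mul]
      _ ≤ D j := hN'.le
  · have e : 4 * (δ / 4 ^ (i' + 1)) = δ / 4 ^ i' := by rw [pow_succ]; field_simp
    rw [e]
    have := hN i' (by omega)
    have e2 : 2 * (τ₀ / 2 ^ j) = τ₀ / 2 ^ k := by rw [hk, pow_succ]; field_simp
    rw [e2]
    exact this.le

lemma vol_ball_enn {n : ℕ} (x : Eu n) {r : ℝ} (hr : 0 < r) :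
    volume (ball x r) = ENNReal.ofReal (r ^ n * volume.real (ball (0 : Eu n) 1)) := by
  rw [← vol_ball_real x hr, measureReal_def, ENNReal.ofReal_toReal measure_ball_lt_top.ne]

lemma ball_vol_sum {n : ℕ} (hn : 2 ≤ n) {r δ : ℝ} (hr : 0 < r) (hδ : r ≤ δ) (x : Eu n) {c : ℝ}
    (hc : 0 < c) :
    volume (ball x (c * r)) ≤
      ENNReal.ofReal (c ^ n * δ * volume.real (ball (0 : Eu n) 1)) * ENNReal.ofReal (r ^ (n - 1)) := by
  rw [vol_ball_enn x (by positivity), ← ENNReal.ofReal_mul (by have := hr.trans_le hδ; positivity)]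
  refine ENNReal.ofReal_le_ofReal ?_
  have : r ^ n = r * r ^ (n - 1) := by rw [← pow_succ']; congr 1; omega
  rw [mul_pow, this]
  calc _ = c ^ n * r * volume.real (ball (0 : Eu n) 1) * r ^ (n - 1) := by ring
    _ ≤ _ := by gcongr

lemma Cov.volume_le {n : ℕ} (hn : 2 ≤ n) {S : Set (Eu n)} {δ : ℝ} {M : ℝ≥0∞} (h : Cov S δ M) :
    volume S ≤ ENNReal.ofReal (δ * volume.real (ball (0 : Eu n) 1)) * M := by
  obtain ⟨ι, hι, x, r, h1, h2, h3⟩ := h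
  refine (measure_mono h2).trans ((measure_iUnion_le _).trans ?_)
  refine le_trans ?_ (mul_le_mul_right h3 _)
  rw [← ENNReal.tsum_mul_left]
  refine ENNReal.tsum_le_tsum fun i => ?_
  simpa using ball_vol_sum hn (h1 i).1 (h1 i).2 (x i) one_pos

lemma volume_zero_of_hausdorff {n : ℕ} (hn : 2 ≤ n) {S : Set (Eu n)}
    (h : μH[(n : ℝ) - 1] S < ⊤) : volume S = 0 := by
  obtain ⟨M, hM, hcov⟩ := cov_of_hausdorff hn h
  have ht : Tendsto (fun δ : ℝ => ENNReal.ofReal (δ * volume.real (ball (0 : Eu n) 1)) * M)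
      (𝓝[>] 0) (𝓝 0) := by
    have h1 : Tendsto (fun δ : ℝ => ENNReal.ofReal (δ * volume.real (ball (0 : Eu n) 1))) (𝓝[>] 0)
        (𝓝 (ENNReal.ofReal (0 * volume.real (ball (0 : Eu n) 1)))) :=
      ENNReal.tendsto_ofReal ((tendsto_nhdsWithin_of_tendsto_nhds tendsto_id).mul_const _)
    have := ENNReal.Tendsto.mul_const (b := M) h1 (Or.inr hM.ne)
    simpa using this
  refine le_antisymm (ge_of_tendsto ht ?_) zero_le
  filter_upwards [self_mem_nhdsWithin] with δ hδ using (hcov δ hδ).volume_le hn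

lemma ae_density {n : ℕ} (hn : 2 ≤ n) {Ω : Set (Eu n)} (hm : MeasurableSet Ω) :
    volume (Ω \ densityPts Ω 1) = 0 := by
  have : Nonempty (Fin n) := ⟨⟨0, by omega⟩⟩
  have h := Besicovitch.ae_tendsto_measure_inter_div_of_measurableSet (volume : Measure (Eu n)) hm
  rw [ae_iff] at h
  refine measure_mono_null (fun x hx => ?_) h
  rw [mem_ofPred_eq]
  intro ht
  apply hx.2
  rw [indicator_of_mem hx.1] at ht
  refine ht.congr fun r => ?_
  have hae : (closedBall x r : Set (Eu n)) =ᵐ[volume] ball x r := by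
    rw [← ball_union_sphere]
    have := Measure.addHaar_sphere (volume : Measure (Eu n)) x r
    exact union_ae_eq_left_of_ae_eq_empty (ae_eq_empty.2 this)
  rw [measure_congr hae, measure_congr ((ae_eq_refl Ω).inter hae)]

lemma vol_diff_interior {n : ℕ} (hn : 2 ≤ n) {Ω : Set (Eu n)} (hm : MeasurableSet Ω)
    (hH : μH[(n : ℝ) - 1] (frontier Ω ∩ densityPts Ω 1) < ⊤) : volume (Ω \ interior Ω) = 0 := by
  refine measure_mono_null (t := (frontier Ω ∩ densityPts Ω 1) ∪ (Ω \ densityPts Ω 1)) ?_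
    (measure_union_null (volume_zero_of_hausdorff hn hH) (ae_density hn hm))
  intro x hx
  by_cases h : x ∈ densityPts Ω 1
  · exact Or.inl ⟨⟨subset_closure hx.1, hx.2⟩, h⟩
  · exact Or.inr ⟨hx.1, h⟩

section
open ContinuousLinearMap

lemma exists_moll {n : ℕ} {Ω : Set (Eu n)} (hb : Bornology.IsBounded Ω)
    (hm : MeasurableSet Ω) {M : ℝ} (hM : ∀ φ, IsTest univ φ → ∫ x in Ω, vdiv φ x ≤ M)
    {δ : ℝ} (hδ : 0 < δ) (τ₀ : ℝ) :
    ∃ w : Eu n → ℝ, ContDiff ℝ (⊤ : ℕ∞) w ∧ HasCompactSupport w ∧ (∀ x, 0 ≤ w x ∧ w x ≤ 1) ∧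
      (∫ x, ‖fderiv ℝ w x‖ ≤ M) ∧
      (∀ x, τ₀ * δ ^ n ≤ volume.real (Ωᶜ ∩ ball x δ) →
        w x ≤ 1 - τ₀ / (2 ^ n * volume.real (ball (0 : Eu n) 1))) ∧
      (∀ x, Ωᶜ ∩ ball x (2 * δ) = ∅ → w x = 1) := by
  set ω := volume.real (ball (0 : Eu n) 1) with hω
  have hωpos : 0 < ω := vol_ball_pos _ one_pos
  let ρ : ContDiffBump (0 : Eu n) := ⟨δ, 2 * δ, hδ, by linarith⟩
  have hΩfin : volume Ω ≠ ⊤ := hb.measure_lt_top.ne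
  set g : Eu n → ℝ := Ω.indicator (fun _ => 1) with hg
  have hgi : Integrable g := (integrable_indicator_iff hm).2 (integrableOn_const hΩfin (by simp))
  have hgs : HasCompactSupport g := by
    refine HasCompactSupport.of_support_subset_isCompact hb.isCompact_closure ?_
    exact (support_indicator_subset).trans subset_closure
  have hgM : ∀ φ, IsTest univ φ → ∫ x, g x * vdiv φ x ≤ M := fun φ hφ => by
    have : (fun x => g x * vdiv φ x) = Ω.indicator (fun x => vdiv φ x) := by
      ext x
      by_cases hx : x ∈ Ω <;> simp [hg, hx]
    rw [this, integral_indicator hm]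
    exact hM φ hφ
  set w := convolution (ρ.normed volume) g (lsmul ℝ ℝ) volume with hw
  have hkint : ∀ x, Integrable (fun y => ρ.normed volume (x - y)) := fun x =>
    ρ.integrable_normed.comp_sub_left x
  have hw1 : ∀ x, w x = ∫ y in Ω, ρ.normed volume (x - y) := fun x => by
    rw [hw, convolution_lsmul_swap, ← integral_indicator hm]
    refine integral_congr_ae (ae_of_all _ fun y => ?_)
    by_cases hy : y ∈ Ω <;> simp [hg, hy]
  have hk1 : ∀ x, ∫ y, ρ.normed volume (x - y) = 1 := fun x => by
    rw [integral_sub_left_eq_self (fun y => ρ.normed volume y) volume x]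
    exact ρ.integral_normed
  have hw2 : ∀ x, w x = 1 - ∫ y in Ωᶜ, ρ.normed volume (x - y) := fun x => by
    rw [hw1, ← hk1 x, ← integral_add_compl hm (hkint x)]; ring
  refine ⟨w, ?_, ?_, fun x => ⟨?_, ?_⟩, moll_bound hgi hgs hgM ρ, fun x hx => ?_, fun x hx => ?_⟩
  · exact HasCompactSupport.contDiff_convolution_left _ ρ.hasCompactSupport_normed
      ρ.contDiff_normed hgi.locallyIntegrable
  · exact HasCompactSupport.convolution _ ρ.hasCompactSupport_normed hgs
  · rw [hw1]; exact integral_nonneg fun y => ρ.nonneg_normed _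
  · rw [hw2]
    have : 0 ≤ ∫ y in Ωᶜ, ρ.normed volume (x - y) := integral_nonneg fun y => ρ.nonneg_normed _
    linarith
  · rw [hw2]
    have hI := ρ.integral_le_measure_closedBall (μ := volume)
    have hI0 := ρ.integral_pos (μ := volume)
    have hI2 : ∫ y, ρ y ≤ (2 * δ) ^ n * ω := by
      refine hI.trans_eq ?_
      rw [measureReal_def, Measure.addHaar_closedBall volume _ ρ.rOut_pos.le]
      change (ENNReal.ofReal ((2 * δ) ^ _) * _).toReal = _
      rw [ENNReal.toReal_mul, ENNReal.toReal_ofReal (by positivity)]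
      simp [hω, measureReal_def]
    have h1 : ∫ y in Ωᶜ ∩ ball x δ, ((2 * δ) ^ n * ω)⁻¹ ≤ ∫ y in Ωᶜ ∩ ball x δ, ρ.normed volume (x - y) := by
      refine setIntegral_mono_on (integrableOn_const
        ((measure_mono inter_subset_right).trans_lt measure_ball_lt_top).ne enorm_ne_top)
        (hkint x).integrableOn (hm.compl.inter measurableSet_ball) fun y hy => ?_
      rw [ρ.normed_def, ρ.one_of_mem_closedBall, one_div]
      · exact inv_anti₀ hI0 hI2
      · rw [mem_closedBall, dist_zero_right, ← dist_eq_norm, dist_comm]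
        exact hy.2.le
    have h2 : ∫ y in Ωᶜ ∩ ball x δ, ρ.normed volume (x - y) ≤ ∫ y in Ωᶜ, ρ.normed volume (x - y) :=
      setIntegral_mono_set (hkint x).integrableOn (ae_of_all _ fun y => ρ.nonneg_normed _)
        (LE.le.eventuallyLE inter_subset_left)
    rw [setIntegral_const, smul_eq_mul] at h1
    have h3 : τ₀ / (2 ^ n * ω) ≤ volume.real (Ωᶜ ∩ ball x δ) * ((2 * δ) ^ n * ω)⁻¹ := by
      rw [← div_eq_mul_inv, div_le_div_iff₀ (by positivity) (by positivity), mul_pow]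
      calc _ = (τ₀ * δ ^ n) * (2 ^ n * ω) := by ring
        _ ≤ _ := by gcongr
    linarith
  · rw [hw2, setIntegral_eq_zero_of_forall_eq_zero, sub_zero]
    intro y hy
    by_contra hne
    have : x - y ∈ Function.support (ρ.normed volume) := hne
    rw [ρ.support_normed_eq, mem_ball, dist_zero_right, ← dist_eq_norm, dist_comm] at this
    have : y ∈ Ωᶜ ∩ ball x (2 * δ) := ⟨hy, this⟩
    rw [hx] at this
    exact this

lemma st_bound : ∃ C : ℝ, 0 < C ∧ ∀ x, |deriv Real.smoothTransition x| ≤ C := by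
  have hc : Continuous (deriv Real.smoothTransition) :=
    (Real.smoothTransition.contDiff (n := 1)).continuous_deriv le_rfl
  obtain ⟨C, hC⟩ := (isCompact_Icc (a := (0 : ℝ)) (b := 1)).exists_bound_of_continuousOn hc.continuousOn
  refine ⟨max C 1, by positivity, fun x => ?_⟩
  by_cases hx : x ∈ Icc (0 : ℝ) 1
  · exact (hC x hx).trans (le_max_left _ _)
  · have : deriv Real.smoothTransition x = 0 := by
      rw [mem_Icc, not_and_or, not_le, not_le] at hx
      rcases hx with hx | hx
      · have : Real.smoothTransition =ᶠ[𝓝 x] fun _ => 0 := by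
          filter_upwards [Iio_mem_nhds hx] with y hy
          exact Real.smoothTransition.zero_of_nonpos (le_of_lt hy)
        rw [this.deriv_eq, deriv_const]
      · have : Real.smoothTransition =ᶠ[𝓝 x] fun _ => 1 := by
          filter_upwards [Ioi_mem_nhds hx] with y hy
          exact Real.smoothTransition.one_of_one_le (le_of_lt hy)
        rw [this.deriv_eq, deriv_const]
    rw [this, abs_zero]; positivity

lemma small_layer {n : ℕ} {Ω : Set (Eu n)} (hb : Bornology.IsBounded Ω) {ε : ℝ} (hε : 0 < ε) :
    ∃ δ₀ > 0, ∀ δ : ℝ, 0 < δ → δ ≤ δ₀ →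
      volume (interior Ω ∩ thickening (2 * δ) Ωᶜ) ≤ ENNReal.ofReal ε := by
  set μ := (volume : Measure (Eu n)).restrict (interior Ω) with hμ
  have hfin : IsFiniteMeasure μ := ⟨by
    rw [hμ, Measure.restrict_apply_univ]
    exact (hb.subset interior_subset).measure_lt_top⟩
  have ht := tendsto_measure_thickening (μ := μ) (s := Ωᶜ) ⟨1, one_pos, measure_ne_top _ _⟩
  have h0 : μ (closure Ωᶜ) = 0 := by
    rw [hμ, Measure.restrict_apply isClosed_closure.measurableSet, closure_compl]
    simp
  rw [h0] at ht
  have he := ht.eventually_lt_const (show (0 : ℝ≥0∞) < ENNReal.ofReal ε by simpa using hε)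
  obtain ⟨ε', hε', hball⟩ := mem_nhdsGT_iff_exists_Ioc_subset.1 he
  have hε'0 : (0 : ℝ) < ε' := hε'
  refine ⟨ε' / 2, by positivity, fun δ hδ hδε => ?_⟩
  have := hball (show 2 * δ ∈ Ioc 0 ε' from ⟨by positivity, by linarith⟩)
  simp only [mem_ofPred_eq] at this
  rw [hμ, Measure.restrict_apply isOpen_thickening.measurableSet] at this
  rw [inter_comm]
  exact this.le

lemma construct_v (n : ℕ) (hn : 2 ≤ n) (Ω : Set (Eu n)) (hb : Bornology.IsBounded Ω)
    (hm : MeasurableSet Ω) (M : ℝ) (hM : ∀ φ, IsTest univ φ → ∫ x in Ω, vdiv φ x ≤ M)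
    (hH : μH[(n : ℝ) - 1] (frontier Ω ∩ densityPts Ω 1) < ⊤) :
    ∃ C : ℝ, ∀ ε > 0, ∃ v : Eu n → ℝ, ContDiff ℝ (⊤ : ℕ∞) v ∧ HasCompactSupport v ∧
      tsupport v ⊆ interior Ω ∧ (∀ x, 0 ≤ v x ∧ v x ≤ 1) ∧ (∫ x, ‖fderiv ℝ v x‖ ≤ C) ∧
      volume (interior Ω \ {x | v x = 1}) ≤ ENNReal.ofReal ε := by
  have hMc : ∀ φ, IsTest univ φ → ∫ x in Ωᶜ, vdiv φ x ≤ M := fun φ hφ => by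
    rw [integral_compl_vdiv hm hφ.cd hφ.cs]
    have := hM _ hφ.neg
    simp_rw [vdiv_neg] at this
    rwa [integral_neg] at this
  obtain ⟨τ₀, hτ₀, M', hM', hcov⟩ := big_cov n hn Ω hm M hMc hH
  obtain ⟨Cs, hCs, hst⟩ := st_bound
  obtain ⟨Cc, hCc, hcut⟩ := exists_multi_cutoff n
  set ω := volume.real (ball (0 : Eu n) 1) with hω
  have hωpos : 0 < ω := vol_ball_pos _ one_pos
  set c : ℝ := min (τ₀ / (2 ^ n * ω) / 2) (1 / 2) with hc
  have hc0 : 0 < c := lt_min (by positivity) (by norm_num)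
  have hc1 : c ≤ 1 / 2 := min_le_right _ _
  have hc2 : 2 * c ≤ τ₀ / (2 ^ n * ω) := by
    have := min_le_left (τ₀ / (2 ^ n * ω) / 2) (1 / 2); linarith
  refine ⟨Cs / c * M + Cc * 2 ^ n * ω * M'.toReal, fun ε hε => ?_⟩
  obtain ⟨δ₀, hδ₀, hlayer⟩ := small_layer hb (show 0 < ε / 2 by positivity)
  set δ₁ := min δ₀ (ε / 2 / (2 ^ n * 12 * ω * (M'.toReal + 1))) with hδ₁
  have hM'0 : 0 ≤ M'.toReal := ENNReal.toReal_nonneg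
  have hδ₁0 : 0 < δ₁ := lt_min hδ₀ (by positivity)
  obtain ⟨δ, hδ, hδδ, hcovδ⟩ := hcov δ₁ hδ₁0
  obtain ⟨w, w1, w2, w3, w4, w5, w6⟩ := exists_moll hb hm hM hδ τ₀
  obtain ⟨ι, hι, x, r, r1, r2, r3⟩ := hcovδ
  -- the compact set to be covered
  set K : Set (Eu n) := {y | y ∈ (interior Ω)ᶜ ∧ 1 - c ≤ w y} with hK
  have hKc : IsCompact K := by
    refine IsCompact.of_isClosed_subset w2 ?_ ?_
    · exact isOpen_interior.isClosed_compl.inter (isClosed_le continuous_const w1.continuous)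
    · intro y hy
      refine subset_tsupport _ (show w y ≠ 0 from ?_)
      have := hy.2
      intro h0; rw [h0] at this; linarith
  have hKsub : K ⊆ ⋃ i, ball (x i) (r i) := by
    refine Subset.trans (fun y hy => ?_) r2
    refine ⟨hy.1, ?_⟩
    by_contra hcon
    have := w5 y (not_lt.1 hcon)
    have := hy.2
    linarith
  obtain ⟨s, hs⟩ := hKc.elim_finite_subcover _ (fun i => isOpen_ball) hKsub
  have hsumE : ∑ i ∈ s, ENNReal.ofReal (r i ^ (n - 1)) ≤ M' := (ENNReal.sum_le_tsum s).trans r3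
  have hsumR : ∑ i ∈ s, r i ^ (n - 1) ≤ M'.toReal := by
    rw [← ENNReal.ofReal_sum_of_nonneg (fun i _ => pow_nonneg (r1 i).1.le _)] at hsumE
    exact (ENNReal.ofReal_le_iff_le_toReal hM'.ne).1 hsumE
  obtain ⟨ψ, p1, p2, p3, p4, p5⟩ := hcut s x r (fun i _ => (r1 i).1)
  set θ : Eu n → ℝ := fun y => Real.smoothTransition ((w y - (1 - c)) / c) with hθ
  have hθ1 : ContDiff ℝ (⊤ : ℕ∞) θ :=
    Real.smoothTransition.contDiff.comp ((w1.sub contDiff_const).div_const c)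
  have hθ01 : ∀ y, 0 ≤ θ y ∧ θ y ≤ 1 := fun y =>
    ⟨Real.smoothTransition.nonneg _, Real.smoothTransition.le_one _⟩
  have hθ0 : ∀ y, w y ≤ 1 - c → θ y = 0 := fun y hy =>
    Real.smoothTransition.zero_of_nonpos (div_nonpos_of_nonpos_of_nonneg (by linarith) hc0.le)
  have hθd : ∀ y, ‖fderiv ℝ θ y‖ ≤ Cs / c * ‖fderiv ℝ w y‖ := fun y => by
    have hwd : HasFDerivAt w (fderiv ℝ w y) y := (w1.differentiable (by simp) y).hasFDerivAt
    have h1 : HasFDerivAt (fun z => (w z - (1 - c)) / c) (c⁻¹ • fderiv ℝ w y) y := by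
      have := (hwd.sub_const (1 - c)).const_smul c⁻¹
      refine this.congr_of_eventuallyEq (Eventually.of_forall fun z => ?_)
      simp [div_eq_inv_mul]
    have h2 : HasDerivAt Real.smoothTransition
        (deriv Real.smoothTransition ((w y - (1 - c)) / c)) ((w y - (1 - c)) / c) :=
      ((Real.smoothTransition.contDiff (n := 1)).differentiable (by norm_num) _).hasDerivAt
    have h3 : HasFDerivAt θ (deriv Real.smoothTransition ((w y - (1 - c)) / c) • c⁻¹ • fderiv ℝ w y) y :=
      HasDerivAt.comp_hasFDerivAt (h₂ := Real.smoothTransition) y h2 h1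
    rw [h3.fderiv, norm_smul, norm_smul, Real.norm_eq_abs, Real.norm_eq_abs, abs_of_pos (inv_pos.2 hc0),
      show Cs / c * ‖fderiv ℝ w y‖ = Cs * (c⁻¹ * ‖fderiv ℝ w y‖) by rw [div_eq_mul_inv, mul_assoc]]
    exact mul_le_mul_of_nonneg_right (hst _) (by positivity)
  set v : Eu n → ℝ := fun y => θ y * ψ y with hv
  have hv1 : ContDiff ℝ (⊤ : ℕ∞) v := hθ1.mul p1
  refine ⟨v, hv1, ?_, ?_, fun y => ?_, ?_, ?_⟩
  · refine w2.mono fun y hy h0 => hy ?_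
    simp only [hv, hθ0 y (by rw [h0]; linarith), zero_mul]
  · intro y hy
    by_contra hyU
    refine (notMem_tsupport_iff_eventuallyEq.2 ?_) hy
    rcases lt_or_ge (w y) (1 - c) with h | h
    · filter_upwards [w1.continuous.continuousAt.eventually_lt_const h] with z hz
      simp [hv, hθ0 z hz.le]
    · have : y ∈ ⋃ i ∈ s, ball (x i) (r i) := hs ⟨hyU, h⟩
      simp only [mem_iUnion] at this
      obtain ⟨i, hi, hyi⟩ := this
      filter_upwards [isOpen_ball.mem_nhds hyi] with z hz
      simp [hv, p3 i hi z (ball_subset_closedBall hz)]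
  · exact ⟨mul_nonneg (hθ01 y).1 (p2 y).1, mul_le_one₀ (hθ01 y).2 (p2 y).1 (p2 y).2⟩
  · have hnormInt : Integrable (fun y => ‖fderiv ℝ w y‖) :=
      (w1.continuous_fderiv (by simp)).norm.integrable_of_hasCompactSupport (w2.fderiv ℝ).norm
    have hI : ∀ i ∈ s, Integrable ((ball (x i) (2 * r i)).indicator (fun _ => Cc / r i))
        (volume : Measure (Eu n)) := fun i _ => (integrable_indicator_iff measurableSet_ball).2
          (integrableOn_const measure_ball_lt_top.ne enorm_ne_top)
    have hIs : Integrable (fun y => ∑ i ∈ s, (ball (x i) (2 * r i)).indicator (fun _ => Cc / r i) y)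
        (volume : Measure (Eu n)) := integrable_finsetSum s hI
    have hpt : ∀ y, ‖fderiv ℝ v y‖ ≤ Cs / c * ‖fderiv ℝ w y‖ +
        ∑ i ∈ s, (ball (x i) (2 * r i)).indicator (fun _ => Cc / r i) y := fun y => by
      rw [hv, fderiv_fun_mul (hθ1.differentiable (by simp) y) (p1.differentiable (by simp) y)]
      refine (norm_add_le _ _).trans ?_
      rw [norm_smul, norm_smul, Real.norm_eq_abs, Real.norm_eq_abs, abs_of_nonneg (hθ01 y).1,
        abs_of_nonneg (p2 y).1, add_comm]
      refine add_le_add ?_ ?_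
      · exact (mul_le_of_le_one_left (norm_nonneg _) (p2 y).2).trans (hθd y)
      · exact (mul_le_of_le_one_left (norm_nonneg _) (hθ01 y).2).trans (p5 y)
    calc ∫ y, ‖fderiv ℝ v y‖ ≤ ∫ y, (Cs / c * ‖fderiv ℝ w y‖ +
        ∑ i ∈ s, (ball (x i) (2 * r i)).indicator (fun _ => Cc / r i) y) :=
          integral_mono_of_nonneg (ae_of_all _ fun y => norm_nonneg _)
            ((hnormInt.const_mul _).add hIs) (ae_of_all _ hpt)
      _ = Cs / c * (∫ y, ‖fderiv ℝ w y‖) +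
          ∑ i ∈ s, Cc * 2 ^ n * ω * r i ^ (n - 1) := by
        rw [integral_add (hnormInt.const_mul _) hIs, integral_const_mul, integral_finsetSum s hI]
        congr 1
        refine Finset.sum_congr rfl fun i hi => ?_
        have hri := (r1 i).1
        have hrn : r i ^ n = r i ^ (n - 1) * r i := by rw [← pow_succ]; congr 1; omega
        rw [integral_indicator measurableSet_ball, setIntegral_const, smul_eq_mul,
          vol_ball_real _ (by positivity), mul_pow, hrn, ← hω]
        field_simp
      _ ≤ _ := by
        rw [← Finset.mul_sum]
        gcongr
  · have hsub : interior Ω \ {y | v y = 1} ⊆ (interior Ω ∩ thickening (2 * δ) Ωᶜ) ∪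
        ⋃ i ∈ s, ball (x i) (2 * r i) := by
      rintro y ⟨hyU, hyv⟩
      by_contra hcon
      rw [mem_union, not_or] at hcon
      apply hyv
      have e1 : ψ y = 1 := p4 y fun i hi hyi => hcon.2 (mem_iUnion₂.2 ⟨i, hi, hyi⟩)
      have e2 : w y = 1 := by
        refine w6 y (eq_empty_of_forall_notMem fun z hz => hcon.1 ⟨hyU, ?_⟩)
        exact mem_thickening_iff.2 ⟨z, hz.1, by rw [dist_comm]; exact hz.2⟩
      have e3 : θ y = 1 := by
        simp only [hθ, e2]
        refine Real.smoothTransition.one_of_one_le ?_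
        rw [le_div_iff₀ hc0]; linarith
      simp [hv, e1, e3]
    have hδ0 : δ ≤ δ₀ := hδδ.trans (min_le_left _ _)
    have h2 : volume (⋃ i ∈ s, ball (x i) (2 * r i)) ≤ ENNReal.ofReal (ε / 2) := by
      refine (measure_biUnion_finset_le s _).trans ?_
      calc ∑ i ∈ s, volume (ball (x i) (2 * r i))
          ≤ ∑ i ∈ s, ENNReal.ofReal (2 ^ n * (12 * δ) * ω) * ENNReal.ofReal (r i ^ (n - 1)) :=
            Finset.sum_le_sum fun i hi => ball_vol_sum hn (r1 i).1 (r1 i).2 (x i) two_pos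
        _ = ENNReal.ofReal (2 ^ n * (12 * δ) * ω * ∑ i ∈ s, r i ^ (n - 1)) := by
          rw [← Finset.mul_sum, ← ENNReal.ofReal_sum_of_nonneg (fun i _ => pow_nonneg (r1 i).1.le _),
            ← ENNReal.ofReal_mul (by positivity)]
        _ ≤ ENNReal.ofReal (ε / 2) := by
          refine ENNReal.ofReal_le_ofReal ?_
          have hd : δ ≤ ε / 2 / (2 ^ n * 12 * ω * (M'.toReal + 1)) := hδδ.trans (min_le_right _ _)
          rw [le_div_iff₀ (by positivity)] at hd
          calc _ ≤ 2 ^ n * (12 * δ) * ω * (M'.toReal + 1) := by gcongr; linarith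
            _ = δ * (2 ^ n * 12 * ω * (M'.toReal + 1)) := by ring
            _ ≤ _ := hd
    calc _ ≤ _ := measure_mono hsub
      _ ≤ _ := measure_union_le _ _
      _ ≤ ENNReal.ofReal (ε / 2) + ENNReal.ofReal (ε / 2) := add_le_add (hlayer δ hδ hδ0) h2
      _ = ENNReal.ofReal ε := by
        rw [← ENNReal.ofReal_add (by positivity) (by positivity)]; congr 1; ring

lemma st_deriv_zero {x : ℝ} (hx : x ∉ Icc (0 : ℝ) 1) : deriv Real.smoothTransition x = 0 := by
  rw [mem_Icc, not_and_or, not_le, not_le] at hx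
  rcases hx with hx | hx
  · have : Real.smoothTransition =ᶠ[𝓝 x] fun _ => 0 := by
      filter_upwards [Iio_mem_nhds hx] with y hy
      exact Real.smoothTransition.zero_of_nonpos (le_of_lt hy)
    rw [this.deriv_eq, deriv_const]
  · have : Real.smoothTransition =ᶠ[𝓝 x] fun _ => 1 := by
      filter_upwards [Ioi_mem_nhds hx] with y hy
      exact Real.smoothTransition.one_of_one_le (le_of_lt hy)
    rw [this.deriv_eq, deriv_const]

/-- Difference quotient of the total variation between level sets. -/
def levQ {n : ℕ} (u : Eu n → ℝ) (k : ℕ) (t : ℝ) : ℝ≥0∞ :=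
  ∫⁻ x, ENNReal.ofReal ((k : ℝ) + 1) *
    {p : ℝ × Eu n | p.1 ≤ u p.2 ∧ u p.2 ≤ p.1 + 1 / ((k : ℝ) + 1)}.indicator
      (fun p => ‖fderiv ℝ u p.2‖ₑ) (t, x)

lemma levQ_meas_aux {n : ℕ} {u : Eu n → ℝ} (hu : ContDiff ℝ 1 u) (k : ℕ) :
    Measurable fun p : ℝ × Eu n => ENNReal.ofReal ((k : ℝ) + 1) *
    {p : ℝ × Eu n | p.1 ≤ u p.2 ∧ u p.2 ≤ p.1 + 1 / ((k : ℝ) + 1)}.indicator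
      (fun p => ‖fderiv ℝ u p.2‖ₑ) p := by
  refine Measurable.const_mul (Measurable.indicator ?_ ?_) _
  · exact ((hu.continuous_fderiv (by norm_num)).comp continuous_snd).enorm.measurable
  · have huc : Continuous fun p : ℝ × Eu n => u p.2 := hu.continuous.comp continuous_snd
    exact ((isClosed_le continuous_fst huc).inter
      (isClosed_le huc (continuous_fst.add continuous_const))).measurableSet

lemma levQ_meas {n : ℕ} {u : Eu n → ℝ} (hu : ContDiff ℝ 1 u) (k : ℕ) : Measurable (levQ u k) :=
  (levQ_meas_aux hu k).lintegral_prod_right'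

lemma levQ_lint {n : ℕ} {u : Eu n → ℝ} (hu : ContDiff ℝ 1 u) (k : ℕ) :
    ∫⁻ t, levQ u k t = ∫⁻ x, ‖fderiv ℝ u x‖ₑ := by
  unfold levQ
  rw [lintegral_lintegral_swap (levQ_meas_aux hu k).aemeasurable]
  refine lintegral_congr fun x => ?_
  have : ∀ t : ℝ, {p : ℝ × Eu n | p.1 ≤ u p.2 ∧ u p.2 ≤ p.1 + 1 / ((k : ℝ) + 1)}.indicator
      (fun p => ‖fderiv ℝ u p.2‖ₑ) (t, x)
      = (Icc (u x - 1 / ((k : ℝ) + 1)) (u x)).indicator (fun _ => ‖fderiv ℝ u x‖ₑ) t := by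
    intro t
    by_cases h : t ≤ u x ∧ u x ≤ t + 1 / ((k : ℝ) + 1)
    · rw [indicator_of_mem (show (t, x) ∈ {p : ℝ × Eu n | p.1 ≤ u p.2 ∧ u p.2 ≤ p.1 + 1 / ((k : ℝ) + 1)} from h),
        indicator_of_mem (show t ∈ Icc _ _ from ⟨by linarith [h.2], h.1⟩)]
    · rw [indicator_of_notMem (show (t, x) ∉ {p : ℝ × Eu n | p.1 ≤ u p.2 ∧ u p.2 ≤ p.1 + 1 / ((k : ℝ) + 1)} from h),
        indicator_of_notMem]
      exact fun h' => h ⟨h'.2, by linarith [h'.1]⟩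
  simp_rw [this]
  rw [lintegral_const_mul' _ _ ENNReal.ofReal_ne_top, lintegral_indicator measurableSet_Icc,
    setLIntegral_const, Real.volume_Icc, mul_comm (‖fderiv ℝ u x‖ₑ), ← mul_assoc,
    ← ENNReal.ofReal_mul (by positivity)]
  have : ((k : ℝ) + 1) * (u x - (u x - 1 / ((k : ℝ) + 1))) = 1 := by field_simp; ring
  rw [this]; simp

lemma perimeter_le_levQ {n : ℕ} {u : Eu n → ℝ} (hu : ContDiff ℝ 1 u) {Cs : ℝ} (hCs : 0 < Cs)
    (hst : ∀ x, |deriv Real.smoothTransition x| ≤ Cs) (t : ℝ) :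
    perimeter {x | t < u x} ≤ ENNReal.ofReal Cs * liminf (fun k => levQ u k t) atTop := by
  unfold perimeter relPerimeter
  simp only [iSup_le_iff]
  intro φ h1 h2 _ h4
  set η : ℕ → Eu n → ℝ := fun k x => Real.smoothTransition (((k : ℝ) + 1) * (u x - t)) with hη
  have hηc : ∀ k, ContDiff ℝ 1 (η k) := fun k =>
    Real.smoothTransition.contDiff.comp (contDiff_const.mul (hu.sub contDiff_const))
  have hE : MeasurableSet {x | t < u x} := (isOpen_lt continuous_const hu.continuous).measurableSet
  have hlim : Tendsto (fun k => ∫ x, η k x * vdiv φ x) atTop (𝓝 (∫ x in {x | t < u x}, vdiv φ x)) := by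
    rw [← integral_indicator hE]
    refine tendsto_integral_of_dominated_convergence (fun x => ‖vdiv φ x‖) (fun k => ?_)
      (vdiv_integrable h1 h2).norm (fun k => ae_of_all _ fun x => ?_) (ae_of_all _ fun x => ?_)
    · exact ((hηc k).continuous.mul (vdiv_continuous h1)).aestronglyMeasurable
    · rw [norm_mul, Real.norm_eq_abs, abs_of_nonneg (Real.smoothTransition.nonneg _)]
      exact mul_le_of_le_one_left (norm_nonneg _) (Real.smoothTransition.le_one _)
    · by_cases hx : t < u x
      · rw [indicator_of_mem (show x ∈ {x | t < u x} from hx)]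
        obtain ⟨N, hN⟩ := exists_nat_gt (1 / (u x - t))
        refine tendsto_const_nhds.congr' ?_
        filter_upwards [eventually_ge_atTop N] with k hk
        have hpos : 0 < u x - t := by linarith
        have : (1 : ℝ) ≤ ((k : ℝ) + 1) * (u x - t) := by
          rw [div_lt_iff₀ hpos] at hN
          have : (N : ℝ) ≤ k := by exact_mod_cast hk
          nlinarith
        simp [hη, Real.smoothTransition.one_of_one_le this]
      · rw [indicator_of_notMem (show x ∉ {x | t < u x} from hx)]
        refine tendsto_const_nhds.congr fun k => ?_
        have : ((k : ℝ) + 1) * (u x - t) ≤ 0 :=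
          mul_nonpos_of_nonneg_of_nonpos (by positivity) (by linarith)
        simp [hη, Real.smoothTransition.zero_of_nonpos this]
  have hlim2 := ENNReal.tendsto_ofReal hlim
  rw [← hlim2.liminf_eq, ← ENNReal.liminf_const_mul_of_ne_top ENNReal.ofReal_ne_top]
  refine liminf_le_liminf (Eventually.of_forall fun k => ?_)
  rw [integral_mul_vdiv (hηc k) h1 h2]
  calc ENNReal.ofReal (-∫ x, fderiv ℝ (η k) x (φ x)) ≤ ‖∫ x, fderiv ℝ (η k) x (φ x)‖ₑ := by
        rw [Real.enorm_eq_ofReal_abs]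
        exact ENNReal.ofReal_le_ofReal (neg_le_abs _)
    _ ≤ ∫⁻ x, ‖fderiv ℝ (η k) x (φ x)‖ₑ := enorm_integral_le_lintegral_enorm _
    _ ≤ ENNReal.ofReal Cs * levQ u k t := by
      unfold levQ
      rw [← lintegral_const_mul' _ _ ENNReal.ofReal_ne_top]
      refine lintegral_mono fun x => ?_
      have hud : HasFDerivAt u (fderiv ℝ u x) x := (hu.differentiable (by norm_num) x).hasFDerivAt
      have e1 : HasFDerivAt (fun z => ((k : ℝ) + 1) * (u z - t)) (((k : ℝ) + 1) • fderiv ℝ u x) x :=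
        (hud.sub_const t).const_mul _
      have e2 : HasDerivAt Real.smoothTransition
          (deriv Real.smoothTransition (((k : ℝ) + 1) * (u x - t))) (((k : ℝ) + 1) * (u x - t)) :=
        ((Real.smoothTransition.contDiff (n := 1)).differentiable (by norm_num) _).hasDerivAt
      have e3 : HasFDerivAt (η k) (deriv Real.smoothTransition (((k : ℝ) + 1) * (u x - t)) •
          ((k : ℝ) + 1) • fderiv ℝ u x) x :=
        HasDerivAt.comp_hasFDerivAt (h₂ := Real.smoothTransition) x e2 e1
      simp only
      rw [e3.fderiv]
      by_cases h : t ≤ u x ∧ u x ≤ t + 1 / ((k : ℝ) + 1)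
      · rw [indicator_of_mem (show (t, x) ∈ {p : ℝ × Eu n | p.1 ≤ u p.2 ∧ u p.2 ≤ p.1 + 1 / ((k : ℝ) + 1)} from h)]
        rw [← ofReal_norm_eq_enorm, ← ofReal_norm_eq_enorm, ← ENNReal.ofReal_mul (by positivity),
          ← ENNReal.ofReal_mul (by positivity)]
        refine ENNReal.ofReal_le_ofReal ?_
        refine (ContinuousLinearMap.le_opNorm _ _).trans ?_
        refine (mul_le_of_le_one_right (norm_nonneg _) (h4 x)).trans ?_
        rw [norm_smul, norm_smul, Real.norm_eq_abs, Real.norm_eq_abs,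
          abs_of_pos (show (0 : ℝ) < (k : ℝ) + 1 by positivity)]
        exact mul_le_mul_of_nonneg_right (hst _) (by positivity)
      · rw [st_deriv_zero, zero_smul]
        · simp
        · rintro ⟨g1, g2⟩
          apply h
          have hk : (0 : ℝ) < (k : ℝ) + 1 := by positivity
          constructor
          · nlinarith
          · have : u x - t ≤ 1 / ((k : ℝ) + 1) := by rw [le_div_iff₀ hk]; linarith
            linarith

lemma coarea {n : ℕ} {Cs : ℝ} (hCs : 0 < Cs) (hst : ∀ x, |deriv Real.smoothTransition x| ≤ Cs)
    {u : Eu n → ℝ} (hu : ContDiff ℝ 1 u) (hus : HasCompactSupport u) {D : ℝ}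
    (hD : ∫ x, ‖fderiv ℝ u x‖ ≤ D) {P : ℝ → Prop} (hP : ∀ᵐ t : ℝ, P t) :
    ∃ t : ℝ, 1 / 4 < t ∧ t < 3 / 4 ∧ P t ∧
      perimeter {x | t < u x} ≤ ENNReal.ofReal (Cs * (4 * (D + 1))) := by
  have hnormInt : Integrable (fun x => ‖fderiv ℝ u x‖) :=
    (hu.continuous_fderiv (by norm_num)).norm.integrable_of_hasCompactSupport (hus.fderiv ℝ).norm
  have hD0 : 0 ≤ D := (integral_nonneg fun _ => norm_nonneg _).trans hD
  have hl : ∫⁻ x, ‖fderiv ℝ u x‖ₑ ≤ ENNReal.ofReal D := by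
    simp_rw [← ofReal_norm_eq_enorm]
    rw [← ofReal_integral_eq_lintegral_ofReal hnormInt (ae_of_all _ fun _ => norm_nonneg _)]
    exact ENNReal.ofReal_le_ofReal hD
  set G : ℝ → ℝ≥0∞ := fun t => liminf (fun k => levQ u k t) atTop with hG
  have hGl : ∫⁻ t, G t ≤ ENNReal.ofReal D := by
    refine (lintegral_liminf_le fun k => levQ_meas hu k).trans ?_
    simp_rw [levQ_lint hu]
    rw [liminf_const]
    exact hl
  by_contra hcon
  push Not at hcon
  have hae : ∀ᵐ t : ℝ, t ∈ Ioo (1 / 4 : ℝ) (3 / 4) → ENNReal.ofReal (4 * (D + 1)) ≤ G t := by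
    filter_upwards [hP] with t ht htI
    have h1 := hcon t htI.1 htI.2 ht
    have h2 := h1.trans_le (perimeter_le_levQ hu hCs hst t)
    rw [ENNReal.ofReal_mul hCs.le] at h2
    exact (lt_of_mul_lt_mul_left' h2).le
  have h1 : ∫⁻ t in Ioo (1 / 4 : ℝ) (3 / 4), ENNReal.ofReal (4 * (D + 1)) ≤ ENNReal.ofReal D :=
    (setLIntegral_mono_ae' measurableSet_Ioo hae).trans ((setLIntegral_le_lintegral _ _).trans hGl)
  rw [setLIntegral_const, Real.volume_Ioo, ← ENNReal.ofReal_mul (by positivity),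
    ENNReal.ofReal_le_ofReal_iff hD0] at h1
  linarith

lemma null_range {n : ℕ} (G : Eu n → Eu n × ℝ) (hG : Differentiable ℝ G) :
    ((volume : Measure (Eu n)).prod (volume : Measure ℝ)) (range G) = 0 := by
  have h := addHaar_image_eq_zero_of_det_fderivWithin_eq_zero
    ((volume : Measure (Eu n)).prod (volume : Measure ℝ)) (s := univ) (f := fun p : Eu n × ℝ => G p.1)
    (f' := fun p => (fderiv ℝ G p.1).comp (ContinuousLinearMap.fst ℝ (Eu n) ℝ))
    (fun p _ => ((hG p.1).hasFDerivAt.comp p hasFDerivAt_fst).hasFDerivWithinAt) ?_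
  · refine measure_mono_null ?_ h
    rintro _ ⟨x, rfl⟩
    exact ⟨(x, 0), mem_univ _, rfl⟩
  · intro p _
    set A := (fderiv ℝ G p.1).comp (ContinuousLinearMap.fst ℝ (Eu n) ℝ) with hA
    refine LinearMap.det_eq_zero_iff_ker_ne_bot.2 fun hk => ?_
    have hinj := LinearMap.ker_eq_bot.1 hk
    have : ((0 : Eu n), (1 : ℝ)) = ((0 : Eu n), (0 : ℝ)) := by
      apply hinj
      simp [hA]
    simp at this

lemma frontier_level {n : ℕ} {u : Eu n → ℝ} (hu : Continuous u) {t : ℝ}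
    (h : ∀ x, u x = t → fderiv ℝ u x ≠ 0) : frontier {x | t < u x} = {x | u x = t} := by
  have ho : IsOpen {x | t < u x} := isOpen_lt continuous_const hu
  rw [ho.frontier_eq]
  ext x
  constructor
  · rintro ⟨h1, h2⟩
    have h3 : t ≤ u x := closure_minimal (fun y (hy : t < u y) => hy.le)
      (isClosed_le continuous_const hu) h1
    exact le_antisymm (not_lt.1 h2) h3
  · intro hx
    have hx' : u x = t := hx
    refine ⟨?_, fun h2 => absurd hx' (ne_of_gt h2)⟩
    by_contra hc
    apply h x hx
    apply IsLocalMax.fderiv_eq_zero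
    have : (closure {x | t < u x})ᶜ ∈ 𝓝 x := isClosed_closure.isOpen_compl.mem_nhds hc
    filter_upwards [this] with y hy
    rw [hx']
    exact not_lt.1 fun h' => hy (subset_closure h')

lemma regular_level {n : ℕ} {Cs : ℝ} (hCs : 0 < Cs)
    (hst : ∀ x, |deriv Real.smoothTransition x| ≤ Cs) {v : Eu n → ℝ}
    (hv : ContDiff ℝ (⊤ : ℕ∞) v) (hvs : HasCompactSupport v) (hv01 : ∀ x, 0 ≤ v x ∧ v x ≤ 1)
    {C : ℝ} (hC : ∫ x, ‖fderiv ℝ v x‖ ≤ C) :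
    ∃ E : Set (Eu n), IsSmoothSet E ∧ IsCompact (closure E) ∧ closure E ⊆ tsupport v ∧
      {x | v x = 1} ⊆ E ∧ perimeter E ≤ ENNReal.ofReal (Cs * (4 * (C + 1 + 1))) := by
  have hv1 : ContDiff ℝ 1 v := hv.of_le (by exact_mod_cast le_top)
  have hvd : Differentiable ℝ v := hv1.differentiable (by norm_num)
  obtain ⟨R, hR0, hR⟩ : ∃ R : ℝ, 0 < R ∧ tsupport v ⊆ ball 0 R := by
    obtain ⟨R, hR⟩ := hvs.isCompact.isBounded.subset_ball 0
    exact ⟨max R 1, by positivity, hR.trans (ball_subset_ball (le_max_left _ _))⟩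
  let χ : ContDiffBump (0 : Eu n) := ⟨R, R + 1, hR0, by linarith⟩
  have hχ : ContDiff ℝ (⊤ : ℕ∞) χ := χ.contDiff
  have hχ1 : ContDiff ℝ 1 χ := χ.contDiff
  have hχd : Differentiable ℝ χ := hχ1.differentiable (by norm_num)
  have hχs : HasCompactSupport χ := χ.hasCompactSupport
  let g : Eu n → ℝ := fun x => |χ x| + ‖x‖ * ‖fderiv ℝ χ x‖
  have hgc : Continuous g := by
    have := (hχ1.continuous_fderiv (by norm_num))
    have := hχ1.continuous
    fun_prop
  have hgs : HasCompactSupport g :=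
    (hχs.norm).add ((hχs.fderiv ℝ).norm.mul_left)
  have hgi : Integrable g := hgc.integrable_of_hasCompactSupport hgs
  set K := ∫ x, g x with hK
  have hK0 : 0 ≤ K := integral_nonneg fun x => by positivity
  -- the bad set
  let D := (InnerProductSpace.toDual ℝ (Eu n)).symm
  let gr : Eu n → Eu n := fun x => D (fderiv ℝ v x)
  have hgrd : Differentiable ℝ gr := by
    have h1 : Differentiable ℝ (fderiv ℝ v) :=
      (hv.fderiv_right (m := 1) (by norm_cast)).differentiable (by norm_num)
    intro x
    exact ((D.toContinuousLinearEquiv : _ ≃L[ℝ] _).differentiable.comp h1) x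
  have hgr : ∀ x y, inner ℝ (gr x) y = fderiv ℝ v x y := fun x y => by
    simp [gr, D]
  let G : Eu n → Eu n × ℝ := fun x => (- gr x, v x - inner ℝ (gr x) x)
  have hGd : Differentiable ℝ G :=
    hgrd.neg.prodMk (hvd.sub (hgrd.inner ℝ differentiable_id))
  have hae : ∀ᵐ a : Eu n, ∀ᵐ t : ℝ, (a, t) ∉ range G := by
    refine Measure.ae_ae_of_ae_prod (p := fun z => z ∉ range G) ?_
    exact measure_eq_zero_iff_ae_notMem.1 (null_range G hGd)
  obtain ⟨δ, hδ0, hδ1, hδ2⟩ : ∃ δ : ℝ, 0 < δ ∧ δ * (R + 1) ≤ 1 / 8 ∧ δ * K ≤ 1 := by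
    refine ⟨1 / (8 * (R + 1 + K)), by positivity, ?_, ?_⟩
    · rw [div_mul_eq_mul_div, div_le_div_iff₀ (by positivity) (by positivity)]; nlinarith
    · rw [div_mul_eq_mul_div, div_le_one (by positivity)]; nlinarith
  obtain ⟨a, ha, haδ⟩ : ∃ a : Eu n, (∀ᵐ t : ℝ, (a, t) ∉ range G) ∧ ‖a‖ < δ := by
    by_contra hcon
    push Not at hcon
    have h0 : (volume : Measure (Eu n)) (ball 0 δ) = 0 := by
      refine measure_mono_null ?_ (ae_iff.1 hae)
      intro a ha hh
      have := hcon a hh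
      rw [mem_ball_zero_iff] at ha
      linarith
    exact (measure_ball_pos volume (0 : Eu n) hδ0).ne' h0
  let L : Eu n →L[ℝ] ℝ := innerSL ℝ a
  have hL : ∀ x, |L x| ≤ ‖a‖ * ‖x‖ := fun x => by
    simpa [L] using abs_real_inner_le_norm a x
  let w : Eu n → ℝ := fun x => χ x * L x
  have hwb : ∀ x, |w x| ≤ 1 / 8 := by
    intro x
    by_cases hx : x ∈ ball (0 : Eu n) (R + 1)
    · rw [mem_ball_zero_iff] at hx
      calc |w x| = |χ x| * |L x| := abs_mul _ _
        _ ≤ 1 * (δ * (R + 1)) := by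
          gcongr
          · rw [abs_of_nonneg χ.nonneg]; exact χ.le_one
          · exact (hL x).trans (by gcongr)
        _ ≤ 1 / 8 := by linarith
    · have : χ x = 0 := by
        apply χ.zero_of_le_dist
        simpa [mem_ball] using hx
      simp only [w, this]; norm_num
  have hwc : ContDiff ℝ (⊤ : ℕ∞) w := hχ.mul L.contDiff
  have hw1 : ContDiff ℝ 1 w := hχ1.mul L.contDiff
  have hws : HasCompactSupport w := hχs.mul_right
  have hwd : ∀ x, ‖fderiv ℝ w x‖ ≤ δ * g x := by
    intro x
    have h1 : fderiv ℝ w x = χ x • L + L x • fderiv ℝ χ x := by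
      have := fderiv_fun_mul (hχd x) L.differentiableAt
      rw [show w = fun y => χ y * L y from rfl, this, L.fderiv]
    rw [h1]
    have hLn : ‖L‖ = ‖a‖ := by simp [L]
    calc ‖χ x • L + L x • fderiv ℝ χ x‖ ≤ ‖χ x • L‖ + ‖L x • fderiv ℝ χ x‖ := norm_add_le _ _
      _ = |χ x| * ‖a‖ + |L x| * ‖fderiv ℝ χ x‖ := by
        rw [norm_smul, norm_smul, hLn, Real.norm_eq_abs, Real.norm_eq_abs]
      _ ≤ |χ x| * δ + (δ * ‖x‖) * ‖fderiv ℝ χ x‖ := by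
        gcongr
        exact (hL x).trans (by gcongr)
      _ = δ * g x := by simp only [g]; ring
  let u : Eu n → ℝ := fun x => v x + w x
  have huc : ContDiff ℝ (⊤ : ℕ∞) u := hv.add hwc
  have hu1 : ContDiff ℝ 1 u := hv1.add hw1
  have hus : HasCompactSupport u := hvs.add hws
  have huD : ∫ x, ‖fderiv ℝ u x‖ ≤ C + 1 := by
    have hvi : Integrable fun x => ‖fderiv ℝ v x‖ :=
      (hv1.continuous_fderiv (by norm_num)).norm.integrable_of_hasCompactSupport (hvs.fderiv ℝ).norm
    calc ∫ x, ‖fderiv ℝ u x‖ ≤ ∫ x, (‖fderiv ℝ v x‖ + δ * g x) := by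
          refine integral_mono_of_nonneg (Eventually.of_forall fun _ => norm_nonneg _)
            (hvi.add (hgi.const_mul δ)) (Eventually.of_forall fun x => ?_)
          have : fderiv ℝ u x = fderiv ℝ v x + fderiv ℝ w x :=
            fderiv_fun_add (hvd x) (hw1.differentiable (by norm_num) x)
          simp only [this]
          exact (norm_add_le _ _).trans (by gcongr; exact hwd x)
      _ = (∫ x, ‖fderiv ℝ v x‖) + δ * K := by
          rw [integral_add hvi (hgi.const_mul δ), integral_const_mul]
      _ ≤ C + 1 := by linarith
  obtain ⟨t, ht1, ht2, htP, hper⟩ := coarea hCs hst hu1 hus huD ha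
  have hts : ∀ x, t ≤ u x → x ∈ tsupport v := by
    intro x hx
    apply subset_tsupport
    have := (abs_le.1 (hwb x)).2
    have h2 : t ≤ v x + w x := hx
    exact (by linarith : 0 < v x).ne'
  have hreg : ∀ x, u x = t → fderiv ℝ u x ≠ 0 := by
    intro x hx h0
    apply htP
    have hxR := hR (hts x hx.ge)
    have hev : u =ᶠ[𝓝 x] fun y => v y + L y := by
      filter_upwards [isOpen_ball.mem_nhds hxR] with y hy
      have : χ y = 1 := χ.one_of_mem_closedBall (ball_subset_closedBall hy)
      simp only [u, w, this, one_mul]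
    have h1 : fderiv ℝ v x + L = 0 := by
      rw [← h0, hev.fderiv_eq, fderiv_fun_add (hvd x) L.differentiableAt, L.fderiv]
    have hag : gr x = - a := by
      refine ext_inner_right ℝ fun y => ?_
      rw [hgr, eq_neg_of_add_eq_zero_left h1]
      simp [L]
    have h3 : u x = v x + L x := hev.self_of_nhds
    refine ⟨x, ?_⟩
    simp only [G, hag, neg_neg, inner_neg_left, sub_neg_eq_add]
    rw [← hx, h3]
    simp [L]
  have hcl : closure {x | t < u x} ⊆ tsupport v :=
    closure_minimal (fun y (hy : t < u y) => hts y hy.le) (isClosed_tsupport v)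
  have hck : IsCompact (closure {x | t < u x}) :=
    hvs.isCompact.of_isClosed_subset isClosed_closure hcl
  have hfr := frontier_level hu1.continuous hreg
  refine ⟨{x | t < u x}, ⟨isOpen_lt continuous_const hu1.continuous,
    hck.isBounded.subset subset_closure, fun x => t - u x, contDiff_const.sub huc, ?_, ?_, ?_⟩,
    hck, hcl, ?_, hper⟩
  · ext x; simp [sub_neg]
  · rw [hfr]; ext x
    exact ⟨fun h => sub_eq_zero.2 (Eq.symm h), fun h => (sub_eq_zero.1 h).symm⟩
  · intro x hx
    rw [hfr] at hx
    rw [fderiv_const_sub]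
    exact neg_ne_zero.2 (hreg x hx)
  · intro x hx
    have hx1 : v x = 1 := hx
    have := (abs_le.1 (hwb x)).1
    change t < v x + w x
    linarith

end

/-- For a bounded set of finite perimeter `Ω ⊆ ℝⁿ` (`n ≥ 2`),
`H^{n-1}(∂Ω ∩ Ω¹) < ∞` iff there are smooth bounded open sets `E k ⋐ Ω` with `E k → Ω` in `L¹`
and `sup_k P(E k) < ∞`. -/
theorem bounded_perimeter_interior_approx_iff (n : ℕ) (hn : 2 ≤ n)
    (Ω : Set (EuclideanSpace ℝ (Fin n)))
    (hb : Bornology.IsBounded Ω) (hm : MeasurableSet Ω) (hper : perimeter Ω ≠ ⊤) :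
    μH[(n : ℝ) - 1] (frontier Ω ∩ densityPts Ω 1) < ⊤ ↔
      ∃ E : ℕ → Set (EuclideanSpace ℝ (Fin n)),
        (∀ k, IsSmoothSet (E k)) ∧
        (∀ k, CpctContained (E k) Ω) ∧
        TendstoL1 E Ω ∧
        (⨆ k, perimeter (E k)) < ⊤ := by
  constructor
  · intro hH
    have hM := (perimeter_le_iff (A := Ω) ENNReal.toReal_nonneg).1 (ENNReal.ofReal_toReal hper).ge
    obtain ⟨C, hC⟩ := construct_v n hn Ω hb hm _ hM hH
    obtain ⟨Cs, hCs, hst⟩ := st_bound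
    have key : ∀ k : ℕ, ∃ E : Set (EuclideanSpace ℝ (Fin n)), IsSmoothSet E ∧
        CpctContained E Ω ∧
        volume ((E \ Ω) ∪ (Ω \ E)) ≤ ENNReal.ofReal (1 / ((k : ℝ) + 1)) ∧
        perimeter E ≤ ENNReal.ofReal (Cs * (4 * (C + 1 + 1))) := by
      intro k
      obtain ⟨v, hv, hvs, hvi, hv01, hvC, hvol⟩ := hC (1 / ((k : ℝ) + 1)) (by positivity)
      obtain ⟨E, hE, hEc, hEt, hE1, hEp⟩ := regular_level hCs hst hv hvs hv01 hvC
      have hEΩ : closure E ⊆ Ω := hEt.trans (hvi.trans interior_subset)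
      refine ⟨E, hE, ⟨hEc, hEΩ⟩, ?_, hEp⟩
      have hsub : (E \ Ω) ∪ (Ω \ E) ⊆ (Ω \ interior Ω) ∪ (interior Ω \ {x | v x = 1}) := by
        rintro x (⟨h1, h2⟩ | ⟨h1, h2⟩)
        · exact absurd (hEΩ (subset_closure h1)) h2
        · by_cases hx : x ∈ interior Ω
          · exact Or.inr ⟨hx, fun h => h2 (hE1 h)⟩
          · exact Or.inl ⟨h1, hx⟩
      refine (measure_mono hsub).trans ((measure_union_le _ _).trans ?_)
      rw [vol_diff_interior hn hm hH, zero_add]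
      exact hvol
    choose E hE1 hE2 hE3 hE4 using key
    refine ⟨E, hE1, hE2, ?_, (iSup_le hE4).trans_lt ENNReal.ofReal_lt_top⟩
    refine tendsto_of_tendsto_of_tendsto_of_le_of_le tendsto_const_nhds ?_
      (fun _ => bot_le) hE3
    have := ENNReal.tendsto_ofReal (tendsto_one_div_add_atTop_nhds_zero_nat (𝕜 := ℝ))
    simpa using this
  · rintro ⟨E, hE1, hE2, hE3, hE4⟩
    exact dir_back n hn Ω hm E hE1 hE2 hE3 hE4
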